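/- (Moving planes up to the critical position.) In the setting of Theorem 2.3 with fixed direction e ∈ ∂B₁(0), with λ₀ the largest λ at which Situation 1 or Situation 2 occurs and λ* = inf{λ ≥ λ₀ : v_μ ≥ 0 in H^μ for all μ > λ}, the statement (S_λ) holds for every λ > λ*; moreover v_{λ*} ≥ 0 in H^{λ*}. -/

import Mathlib

open MeasureTheory Set Filter Metric Asymptotics
open scoped RealInnerProductSpace ENNReal Topology NNReal

noncomputable section

abbrev Rd (d : ℕ) := EuclideanSpace ℝ (Fin d)

/-- The data of a Bernstein function `Ψ` vanishing at `0`, its Lévy measure `𝔪`,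
and the weak scaling conditions. -/
structure PsiSetting (d : ℕ) where
  Ψ : ℝ → ℝ
  m : Measure ℝ
  m_onIoi : m (Set.Iic 0) = 0
  smooth : ContDiffOn ℝ (⊤ : ℕ∞) Ψ (Set.Ioi 0)
  nonneg : ∀ x > (0:ℝ), 0 ≤ Ψ x
  deriv_alt : ∀ n : ℕ, ∀ x > (0:ℝ),
    (-1 : ℝ) ^ (n + 1) * iteratedDerivWithin (n + 1) Ψ (Set.Ioi 0) x ≤ 0
  zero_lim : Filter.Tendsto Ψ (nhdsWithin 0 (Set.Ioi 0)) (nhds 0)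
  levy_rep : ∀ lam > (0:ℝ), Ψ lam = ∫ t, (1 - Real.exp (-lam * t)) ∂m
  a₁ : ℝ
  a₂ : ℝ
  b₁ : ℝ
  b₂ : ℝ
  ha₁ : 0 < a₁
  ha₁₂ : a₁ ≤ a₂
  ha₂ : a₂ < 1
  hb₁ : 1 ≤ b₁
  hb₂ : 1 < b₂
  scaling_lower : ∀ r R : ℝ, 1 ≤ r → r ≤ R → (1 / b₁) * (R / r) ^ a₁ ≤ Ψ R / Ψ r
  scaling_upper : ∀ r R : ℝ, 1 ≤ r → r ≤ R → Ψ R / Ψ r ≤ b₁ * (R / r) ^ a₂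

/-- The jump kernel `j(r) = ∫_0^∞ (4πt)^{-d/2} e^{-r²/(4t)} 𝔪(dt)`. -/
def PsiSetting.j {d : ℕ} (S : PsiSetting d) (r : ℝ) : ℝ :=
  ∫ t, (4 * Real.pi * t) ^ (-(d : ℝ) / 2) * Real.exp (-(r ^ 2) / (4 * t)) ∂S.m

/-- The condition `j(r) ≤ b₂ j(r+1)` for `r ≥ 1`. -/
def PsiSetting.kernelCond {d : ℕ} (S : PsiSetting d) : Prop :=
  ∀ r : ℝ, 1 ≤ r → S.j r ≤ S.b₂ * S.j (r + 1)

/-- The nonlocal operator `Ψ(−Δ)` applied to a test function. -/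
def psiOp {d : ℕ} (S : PsiSetting d) (φ : Rd d → ℝ) (x : Rd d) : ℝ :=
  ∫ z : Rd d,
    (φ x - φ (x + z) + (if ‖z‖ ≤ 1 then ⟪z, gradient φ x⟫ else 0)) * S.j ‖z‖

/-- Admissible test functions at `x`: bounded continuous and C² near `x`. -/
def TestAt {d : ℕ} (x : Rd d) (φ : Rd d → ℝ) : Prop :=
  (∃ M, ∀ y, |φ y| ≤ M) ∧ Continuous φ ∧ ∃ U ∈ nhds x, ContDiffOn ℝ 2 φ U

/-- Viscosity supersolution of `Ψ(−Δ)u + c·u = g` in `Ω`. -/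
def IsSuperSol {d : ℕ} (S : PsiSetting d) (Ω : Set (Rd d)) (c g u : Rd d → ℝ) : Prop :=
  LowerSemicontinuous u ∧
    ∀ x ∈ Ω, ∀ φ : Rd d → ℝ, TestAt x φ → φ x = u x → (∀ y, y ≠ x → φ y < u y) →
      g x ≤ psiOp S φ x + c x * u x

/-- Viscosity subsolution of `Ψ(−Δ)u + c·u = g` in `Ω`. -/
def IsSubSol {d : ℕ} (S : PsiSetting d) (Ω : Set (Rd d)) (c g u : Rd d → ℝ) : Prop :=
  UpperSemicontinuous u ∧
    ∀ x ∈ Ω, ∀ φ : Rd d → ℝ, TestAt x φ → φ x = u x → (∀ y, y ≠ x → u y < φ y) →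
      psiOp S φ x + c x * u x ≤ g x

/-- Viscosity solution of `Ψ(−Δ)u + c·u = g` in `Ω`. -/
def IsSol {d : ℕ} (S : PsiSetting d) (Ω : Set (Rd d)) (c g u : Rd d → ℝ) : Prop :=
  IsSubSol S Ω c g u ∧ IsSuperSol S Ω c g u

/-- `V` is the renewal function of the ascending ladder-height process associated with `Ψ`. -/
structure IsRenewal (Ψ V : ℝ → ℝ) : Prop where
  nonneg : ∀ x, 0 ≤ V x
  zero : ∀ x ≤ (0:ℝ), V x = 0
  cont : ContinuousOn V (Set.Ioi 0)
  mono : StrictMonoOn V (Set.Ioi 0)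
  laplace : ∀ s : ℝ, 0 < s →
    (∫ x in Set.Ioi (0 : ℝ), V x * Real.exp (-s * x)) =
      1 / (s * Real.exp ((1 / Real.pi) *
        ∫ y in Set.Ioi (0 : ℝ), Real.log (Ψ (s * y)) / (1 + y ^ 2)))

/-- `tr_V(u)(x) = t`: the `V`-trace of `u` at the boundary point `x` of `D`. -/
def HasVTrace {d : ℕ} (V : ℝ → ℝ) (D : Set (Rd d)) (u : Rd d → ℝ)
    (x : Rd d) (t : ℝ) : Prop :=
  Filter.Tendsto (fun z => u z / V (Metric.infDist z Dᶜ)) (nhdsWithin x D) (nhds t)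

/-- An open set has C² boundary. -/
def HasC2Boundary {d : ℕ} (D : Set (Rd d)) : Prop :=
  ∀ x ∈ frontier D, ∃ (U : Set (Rd d)) (f : Rd d → ℝ),
    IsOpen U ∧ x ∈ U ∧ ContDiffOn ℝ 2 f U ∧ (∀ y ∈ U, fderiv ℝ f y ≠ 0) ∧
      D ∩ U = {y ∈ U | f y < 0}

/-- A closed set has C² boundary. -/
def HasC2BoundaryClosed {d : ℕ} (G : Set (Rd d)) : Prop :=
  ∀ x ∈ frontier G, ∃ (U : Set (Rd d)) (f : Rd d → ℝ),
    IsOpen U ∧ x ∈ U ∧ ContDiffOn ℝ 2 f U ∧ (∀ y ∈ U, fderiv ℝ f y ≠ 0) ∧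
      G ∩ U = {y ∈ U | f y ≤ 0}

/-- Reflection `R_{λ,e}` across the hyperplane `{x·e = λ}`. -/
def reflAt {d : ℕ} (e : Rd d) (lam : ℝ) (x : Rd d) : Rd d :=
  x - (2 * ⟪x, e⟫ - 2 * lam) • e

/-- The open half-space `H_{λ,e} = {x·e > λ}`. -/
def halfSpace {d : ℕ} (e : Rd d) (lam : ℝ) : Set (Rd d) := {x | lam < ⟪x, e⟫}

/-- A function is antisymmetric with respect to the half-space `H_{λ,e}`. -/
def AntiSym {d : ℕ} (e : Rd d) (lam : ℝ) (u : Rd d → ℝ) : Prop :=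
  ∀ x, u x = - u (reflAt e lam x)

/-- The hyperplane `{x·e = λ}` is orthogonal to `∂G` at `p` (expressed through
a local C² defining function of `G` near `p`). -/
def OrthAt {d : ℕ} (G : Set (Rd d)) (e p : Rd d) : Prop :=
  ∃ (U : Set (Rd d)) (f : Rd d → ℝ), IsOpen U ∧ p ∈ U ∧ ContDiffOn ℝ 2 f U ∧
    fderiv ℝ f p ≠ 0 ∧ G ∩ U = {y ∈ U | f y ≤ 0} ∧ fderiv ℝ f p e = 0

/-- Situation 1: a touching point `p₀ ∈ ∂G ∩ ∂R_{λ,e}(G ∩ H_{λ,e})` away from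
the hyperplane `{x·e = λ}`. -/
def Sit1 {d : ℕ} (G : Set (Rd d)) (e : Rd d) (lam : ℝ) : Prop :=
  ∃ p, p ∈ frontier G ∧
    p ∈ frontier (reflAt e lam '' (G ∩ halfSpace e lam)) ∧ ⟪p, e⟫ ≠ lam

/-- Situation 2: the hyperplane `{x·e = λ}` is orthogonal to `∂G` at some
point `p₀ ∈ ∂G ∩ {x·e = λ}`. -/
def Sit2 {d : ℕ} (G : Set (Rd d)) (e : Rd d) (lam : ℝ) : Prop :=
  ∃ p, p ∈ frontier G ∧ ⟪p, e⟫ = lam ∧ OrthAt G e p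

/-- The Gauss–Weierstrass kernel at distance `r` and time `t`. -/
def heatKernel (d : ℕ) (r t : ℝ) : ℝ :=
  (4 * Real.pi * t) ^ (-(d : ℝ) / 2) * Real.exp (-(r ^ 2) / (4 * t))

lemma heatKernel_pos (d : ℕ) (r : ℝ) {t : ℝ} (ht : 0 < t) : 0 < heatKernel d r t := by
  unfold heatKernel
  positivity

lemma heatKernel_lt (d : ℕ) {r s t : ℝ} (hr : 0 < r) (hrs : r < s) (ht : 0 < t) :
    heatKernel d s t < heatKernel d r t := by
  unfold heatKernel
  have h : -(s ^ 2) / (4 * t) < -(r ^ 2) / (4 * t) := by gcongr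
  have := Real.exp_lt_exp.2 h
  gcongr

lemma div_one_add_le_one_sub_exp {t : ℝ} (ht : 0 < t) : t / (1 + t) ≤ 1 - Real.exp (-t) := by
  have h1 := Real.add_one_le_exp t
  rw [Real.exp_neg, div_le_iff₀ (by linarith)]
  have h2 : (Real.exp t)⁻¹ ≤ (1 + t)⁻¹ := by
    apply inv_anti₀ <;> linarith
  have h3 : (1 + t)⁻¹ * (1 + t) = 1 := inv_mul_cancel₀ (by linarith)
  nlinarith

lemma min_one_le_one_sub_exp {t : ℝ} (ht : 0 < t) : min 1 t ≤ 2 * (1 - Real.exp (-t)) := by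
  refine le_trans ?_ (mul_le_mul_of_nonneg_left (div_one_add_le_one_sub_exp ht) zero_le_two)
  rw [← mul_div_assoc, le_div_iff₀ (by linarith)]
  rcases le_total 1 t with h | h
  · rw [min_eq_left h]; linarith
  · rw [min_eq_right h]; nlinarith

lemma exists_heatKernel_le (d : ℕ) {r : ℝ} (hr : 0 < r) :
    ∃ C : ℝ, ∀ t > 0, heatKernel d r t ≤ C * (1 - Real.exp (-t)) := by
  set K : ℝ := ((d + 1).factorial : ℝ) * (4 / r ^ 2) ^ (d + 1)
  have hK : 0 ≤ K := by positivity
  refine ⟨(K + 1) * 2, fun t ht => ?_⟩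
  suffices h : heatKernel d r t ≤ (K + 1) * min 1 t by
    have := min_one_le_one_sub_exp ht
    nlinarith
  have hpi : 1 ≤ 4 * Real.pi := by linarith [Real.pi_gt_three]
  unfold heatKernel
  rcases le_total 1 t with h | h
  · rw [min_eq_left h]
    have h1 : (4 * Real.pi * t) ^ (-(d : ℝ) / 2) ≤ 1 := by
      apply Real.rpow_le_one_of_one_le_of_nonpos
      · nlinarith
      · have : (0 : ℝ) ≤ d := Nat.cast_nonneg d
        linarith
    have h2 : Real.exp (-(r ^ 2) / (4 * t)) ≤ 1 := by
      rw [Real.exp_le_one_iff]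
      apply div_nonpos_of_nonpos_of_nonneg <;> nlinarith
    have := mul_le_one₀ h1 (Real.exp_pos _).le h2
    linarith
  · rw [min_eq_right h]
    have h1 : (4 * Real.pi * t) ^ (-(d : ℝ) / 2) ≤ (t ^ d)⁻¹ := by
      calc (4 * Real.pi * t) ^ (-(d : ℝ) / 2) ≤ t ^ (-(d : ℝ) / 2) := by
            apply Real.rpow_le_rpow_of_nonpos ht
            · nlinarith
            · have : (0 : ℝ) ≤ d := Nat.cast_nonneg d
              linarith
        _ ≤ t ^ (-(d : ℝ)) := by
            apply Real.rpow_le_rpow_of_exponent_ge ht h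
            have : (0 : ℝ) ≤ d := Nat.cast_nonneg d
            linarith
        _ = (t ^ d)⁻¹ := by rw [Real.rpow_neg ht.le, Real.rpow_natCast]
    have h2 : Real.exp (-(r ^ 2) / (4 * t)) ≤ K * t ^ (d + 1) := by
      have hx : 0 < r ^ 2 / (4 * t) := by positivity
      have h3 := Real.pow_div_factorial_le_exp _ hx.le (d + 1)
      rw [neg_div, Real.exp_neg]
      have h4 : (Real.exp (r ^ 2 / (4 * t)))⁻¹ ≤
          ((r ^ 2 / (4 * t)) ^ (d + 1) / ((d + 1).factorial : ℝ))⁻¹ :=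
        inv_anti₀ (by positivity) h3
      refine h4.trans_eq ?_
      simp only [K, div_pow, mul_pow]
      field_simp
    calc _ ≤ (t ^ d)⁻¹ * (K * t ^ (d + 1)) := by gcongr
      _ = K * t := by rw [pow_succ]; field_simp
      _ ≤ (K + 1) * t := by nlinarith

lemma integral_heatKernel (d : ℕ) {t : ℝ} (ht : 0 < t) :
    ∫ z : Rd d, heatKernel d ‖z‖ t = 1 := by
  have h := GaussianFourier.integral_rexp_neg_mul_sq_norm (V := Rd d) (b := 1 / (4 * t))
    (by positivity)
  unfold heatKernel
  rw [integral_const_mul]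
  have h' : (fun z : Rd d => Real.exp (-(‖z‖ ^ 2) / (4 * t))) =
      fun z : Rd d => Real.exp (-(1 / (4 * t)) * ‖z‖ ^ 2) := by
    ext z; congr 1; ring
  rw [h', h, finrank_euclideanSpace_fin, show Real.pi / (1 / (4 * t)) = 4 * Real.pi * t by
    field_simp, ← Real.rpow_add (by positivity)]
  rw [show -(d : ℝ) / 2 + d / 2 = 0 by ring, Real.rpow_zero]

lemma integrable_heatKernel (d : ℕ) {t : ℝ} (ht : 0 < t) :
    Integrable fun z : Rd d => heatKernel d ‖z‖ t :=
  integrable_of_integral_eq_one (integral_heatKernel d ht)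

lemma sq_mul_heatKernel_le (d : ℕ) (r : ℝ) {t : ℝ} (ht : 0 < t) :
    r ^ 2 * heatKernel d r t ≤ 8 * t * 2 ^ ((d : ℝ) / 2) * heatKernel d r (2 * t) := by
  have h1 : (4 * Real.pi * (2 * t)) ^ (-(d : ℝ) / 2) =
      (2 ^ ((d : ℝ) / 2))⁻¹ * (4 * Real.pi * t) ^ (-(d : ℝ) / 2) := by
    rw [show 4 * Real.pi * (2 * t) = 2 * (4 * Real.pi * t) by ring,
      Real.mul_rpow (by positivity) (by positivity), neg_div, Real.rpow_neg zero_le_two]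
  have hs : r ^ 2 ≤ 8 * t * Real.exp (r ^ 2 / (8 * t)) := by
    have := Real.add_one_le_exp (r ^ 2 / (8 * t))
    have h2 : r ^ 2 = 8 * t * (r ^ 2 / (8 * t)) := by field_simp
    calc r ^ 2 = 8 * t * (r ^ 2 / (8 * t)) := h2
      _ ≤ _ := by gcongr; linarith
  have he : Real.exp (-(r ^ 2) / (4 * (2 * t))) =
      Real.exp (r ^ 2 / (8 * t)) * Real.exp (-(r ^ 2) / (4 * t)) := by
    rw [← Real.exp_add]; congr 1; field_simp; ring
  unfold heatKernel
  rw [h1, he]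
  have h2 : (2 : ℝ) ^ ((d : ℝ) / 2) ≠ 0 := by positivity
  calc r ^ 2 * ((4 * Real.pi * t) ^ (-(d : ℝ) / 2) * Real.exp (-(r ^ 2) / (4 * t)))
      ≤ (8 * t * Real.exp (r ^ 2 / (8 * t))) *
        ((4 * Real.pi * t) ^ (-(d : ℝ) / 2) * Real.exp (-(r ^ 2) / (4 * t))) := by gcongr
    _ = _ := by field_simp

lemma integral_min_mul_heatKernel_le (d : ℕ) {t : ℝ} (ht : 0 < t) :
    Integrable (fun z : Rd d => min 1 (‖z‖ ^ 2) * heatKernel d ‖z‖ t) ∧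
    ∫ z : Rd d, min 1 (‖z‖ ^ 2) * heatKernel d ‖z‖ t ≤
      (1 + 8 * 2 ^ ((d : ℝ) / 2)) * min 1 t := by
  have h1 : ∀ z : Rd d, min 1 (‖z‖ ^ 2) * heatKernel d ‖z‖ t ≤ heatKernel d ‖z‖ t := fun z =>
    mul_le_of_le_one_left (heatKernel_pos d _ ht).le (min_le_left _ _)
  have h2 : ∀ z : Rd d, min 1 (‖z‖ ^ 2) * heatKernel d ‖z‖ t ≤
      8 * t * 2 ^ ((d : ℝ) / 2) * heatKernel d ‖z‖ (2 * t) := fun z =>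
    (mul_le_mul_of_nonneg_right (min_le_right _ _) (heatKernel_pos d _ ht).le).trans
      (sq_mul_heatKernel_le d _ ht)
  have hint : Integrable (fun z : Rd d => min 1 (‖z‖ ^ 2) * heatKernel d ‖z‖ t) := by
    refine (integrable_heatKernel d ht).mono' ?_ (ae_of_all _ fun z => ?_)
    · exact ((continuous_const.min (continuous_norm.pow 2)).aestronglyMeasurable).mul
        (integrable_heatKernel d ht).1
    · rw [Real.norm_of_nonneg (mul_nonneg (by positivity) (heatKernel_pos d _ ht).le)]
      exact h1 z
  refine ⟨hint, ?_⟩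
  have hp : (0 : ℝ) < 2 ^ ((d : ℝ) / 2) := by positivity
  rcases le_total 1 t with h | h
  · rw [min_eq_left h]
    have := integral_mono hint (integrable_heatKernel d ht) h1
    rw [integral_heatKernel d ht] at this
    linarith
  · rw [min_eq_right h]
    have ht2 : 0 < 2 * t := by linarith
    have := integral_mono hint ((integrable_heatKernel d ht2).const_mul _) h2
    rw [integral_const_mul, integral_heatKernel d ht2] at this
    nlinarith

namespace PsiSetting

variable {d : ℕ} (S : PsiSetting d)

lemma ae_pos : ∀ᵐ t ∂S.m, 0 < t := by
  rw [ae_iff]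
  convert S.m_onIoi using 2
  ext t; simp

lemma psi_one_pos : 0 < S.Ψ 1 := by
  have h := S.scaling_lower 1 1 le_rfl le_rfl
  have hb := S.hb₁
  rcases (S.nonneg 1 one_pos).lt_or_eq with h' | h'
  · exact h'
  · rw [← h'] at h
    simp only [div_one, Real.one_rpow, mul_one, div_zero] at h
    have : 0 < 1 / S.b₁ := by positivity
    linarith

lemma integrable_one_sub_exp : Integrable (fun t => 1 - Real.exp (-t)) S.m := by
  by_contra h
  have h1 := S.levy_rep 1 one_pos
  simp only [neg_mul, one_mul] at h1
  rw [integral_undef h] at h1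
  exact S.psi_one_pos.ne' h1

lemma measure_ne_zero : S.m ≠ 0 := by
  intro h
  have h1 := S.levy_rep 1 one_pos
  rw [h, integral_zero_measure] at h1
  exact S.psi_one_pos.ne' h1

instance sigmaFinite_m : SigmaFinite S.m := by
  refine ⟨⟨⟨fun n : ℕ => Set.Iic 0 ∪ Set.Ici (1 / ((n : ℝ) + 1)), fun _ => trivial,
    fun n => ?_, ?_⟩⟩⟩
  · refine (measure_union_le _ _).trans_lt ?_
    rw [S.m_onIoi, zero_add]
    have hp : (0 : ℝ) < 1 / ((n : ℝ) + 1) := by positivity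
    have hpos : 0 < 1 - Real.exp (-(1 / ((n : ℝ) + 1))) := by
      rw [sub_pos, Real.exp_lt_one_iff]
      linarith
    refine (measure_mono fun t ht => ?_).trans_lt
      (S.integrable_one_sub_exp.measure_ge_lt_top hpos)
    have : Real.exp (-t) ≤ Real.exp (-(1 / ((n : ℝ) + 1))) :=
      Real.exp_le_exp.2 (neg_le_neg ht)
    change 1 - Real.exp (-(1 / ((n : ℝ) + 1))) ≤ 1 - Real.exp (-t)
    linarith
  · refine Set.eq_univ_of_forall fun t => Set.mem_iUnion.2 ?_
    rcases le_or_gt t 0 with h | h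
    · exact ⟨0, Or.inl h⟩
    · obtain ⟨n, hn⟩ := exists_nat_one_div_lt h
      exact ⟨n, Or.inr hn.le⟩

lemma j_eq (r : ℝ) : S.j r = ∫ t, heatKernel d r t ∂S.m := rfl

lemma j_nonneg (r : ℝ) : 0 ≤ S.j r := by
  refine integral_nonneg_of_ae ?_
  filter_upwards [S.ae_pos] with t ht
  exact (heatKernel_pos d r ht).le

lemma measurable_heatKernel : Measurable fun p : ℝ × ℝ => heatKernel d p.1 p.2 := by
  unfold heatKernel
  fun_prop

lemma integrable_heatKernel_m {r : ℝ} (hr : 0 < r) :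
    Integrable (fun t => heatKernel d r t) S.m := by
  obtain ⟨C, hC⟩ := exists_heatKernel_le d hr
  refine (S.integrable_one_sub_exp.const_mul C).mono' ?_ ?_
  · exact (measurable_heatKernel.comp measurable_prodMk_left).aestronglyMeasurable
  · filter_upwards [S.ae_pos] with t ht
    rw [Real.norm_of_nonneg (heatKernel_pos d r ht).le]
    exact hC t ht

lemma j_strictAntiOn : StrictAntiOn S.j (Set.Ioi 0) := by
  intro r hr s hs hrs
  rw [j_eq, j_eq, ← sub_pos,
    ← integral_sub (S.integrable_heatKernel_m hr) (S.integrable_heatKernel_m hs)]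
  rw [integral_pos_iff_support_of_nonneg_ae]
  · by_contra h
    apply S.measure_ne_zero
    have h0 : S.m (Set.Ioi 0) = 0 := by
      refine measure_mono_null (fun t ht => ?_) (nonpos_iff_eq_zero.1 (not_lt.1 h))
      rw [Function.mem_support]
      exact (sub_pos.2 (heatKernel_lt d hr hrs ht)).ne'
    rw [← Measure.measure_univ_eq_zero, ← Set.Iic_union_Ioi (a := (0 : ℝ))]
    exact measure_union_null S.m_onIoi h0
  · filter_upwards [S.ae_pos] with t ht
    exact (sub_pos.2 (heatKernel_lt d hr hrs ht)).le
  · exact (S.integrable_heatKernel_m hr).sub (S.integrable_heatKernel_m hs)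

lemma measurable_j : Measurable S.j :=
  (StronglyMeasurable.integral_prod_right (f := fun r t => heatKernel d r t)
    measurable_heatKernel.stronglyMeasurable).measurable

lemma integrable_min_mul_j : Integrable fun z : Rd d => min 1 (‖z‖ ^ 2) * S.j ‖z‖ := by
  have hmeas : Measurable fun p : Rd d × ℝ => min 1 (‖p.1‖ ^ 2) * heatKernel d ‖p.1‖ p.2 :=
    (by fun_prop : Measurable fun p : Rd d × ℝ => min 1 (‖p.1‖ ^ 2)).mul
      (measurable_heatKernel.comp (measurable_fst.norm.prodMk measurable_snd))
  have hint : Integrable (fun p : Rd d × ℝ => min 1 (‖p.1‖ ^ 2) * heatKernel d ‖p.1‖ p.2)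
      (volume.prod S.m) := by
    rw [integrable_prod_iff' hmeas.aestronglyMeasurable]
    constructor
    · filter_upwards [S.ae_pos] with t ht
      exact (integral_min_mul_heatKernel_le d ht).1
    · refine (S.integrable_one_sub_exp.const_mul
        ((1 + 8 * 2 ^ ((d : ℝ) / 2)) * 2)).mono' ?_ ?_
      · exact (hmeas.norm.stronglyMeasurable.integral_prod_left').aestronglyMeasurable
      · filter_upwards [S.ae_pos] with t ht
        have hn : ∀ z : Rd d, ‖min 1 (‖z‖ ^ 2) * heatKernel d ‖z‖ t‖ =
            min 1 (‖z‖ ^ 2) * heatKernel d ‖z‖ t := fun z =>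
          Real.norm_of_nonneg (mul_nonneg (by positivity) (heatKernel_pos d _ ht).le)
        simp only [hn]
        rw [Real.norm_of_nonneg (integral_nonneg fun z =>
          mul_nonneg (by positivity) (heatKernel_pos d _ ht).le)]
        refine (integral_min_mul_heatKernel_le d ht).2.trans ?_
        rw [mul_assoc]
        have := min_one_le_one_sub_exp ht
        gcongr
  have := hint.integral_prod_left
  simpa only [integral_const_mul, ← j_eq] using this

end PsiSetting

lemma integral_eq_zero_of_odd {d : ℕ} {h : Rd d → ℝ} (hodd : ∀ z, h (-z) = -h z) :
    ∫ z, h z = 0 := by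
  have h1 := integral_neg_eq_self h volume
  simp only [hodd, integral_neg] at h1
  linarith

lemma tendsto_setIntegral_ball_zero {d : ℕ} (hd : 0 < d) {h : Rd d → ℝ} {x : Rd d}
    (hint : IntegrableOn h (ball x 1)) :
    Tendsto (fun n : ℕ => ∫ z in ball x (1 / ((n : ℝ) + 1)), h z) atTop (𝓝 0) := by
  have hanti : Antitone fun n : ℕ => ball x (1 / ((n : ℝ) + 1)) := fun m n hmn =>
    ball_subset_ball (one_div_le_one_div_of_le (by positivity) (by gcongr))
  have h1 := tendsto_setIntegral_of_antitone (fun n => measurableSet_ball) hanti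
    (f := h) (μ := volume) ⟨0, by simpa using hint⟩
  have h2 : ⋂ n : ℕ, ball x (1 / ((n : ℝ) + 1)) = {x} := by
    ext y
    simp only [mem_iInter, mem_ball, mem_singleton_iff]
    constructor
    · intro hy
      by_contra hne
      obtain ⟨n, hn⟩ := exists_nat_one_div_lt (dist_pos.2 hne)
      exact absurd (hy n) (not_lt.2 hn.le)
    · rintro rfl n
      rw [dist_self]; positivity
  rw [h2] at h1
  have : Nonempty (Fin d) := ⟨⟨0, hd⟩⟩
  have : Nontrivial (Rd d) := inferInstance
  rwa [setIntegral_measure_zero h (measure_singleton x)] at h1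

namespace PsiSetting

variable {d : ℕ} (S : PsiSetting d)

lemma integrable_mul_j {h : Rd d → ℝ} {C : ℝ} (hm : Measurable h)
    (hb : ∀ z, |h z| ≤ C * min 1 (‖z‖ ^ 2)) : Integrable fun z => h z * S.j ‖z‖ := by
  refine (S.integrable_min_mul_j.const_mul C).mono'
    (hm.mul (S.measurable_j.comp measurable_norm)).aestronglyMeasurable
    (ae_of_all _ fun z => ?_)
  rw [norm_mul, Real.norm_eq_abs, Real.norm_of_nonneg (S.j_nonneg _), ← mul_assoc]
  exact mul_le_mul_of_nonneg_right (hb z) (S.j_nonneg _)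

lemma integrableOn_mul_j_compl_ball {h : Rd d → ℝ} {M δ : ℝ} (hδ : 0 < δ) (hm : Measurable h)
    (hb : ∀ z, |h z| ≤ M) : IntegrableOn (fun z => h z * S.j ‖z‖) (ball 0 δ)ᶜ := by
  rw [← integrable_indicator_iff measurableSet_ball.compl]
  have hM : 0 ≤ M := (abs_nonneg _).trans (hb 0)
  have hmin : 0 < min 1 (δ ^ 2) := by positivity
  have := S.integrable_mul_j (h := (ball (0 : Rd d) δ)ᶜ.indicator h) (C := M / min 1 (δ ^ 2))
    (hm.indicator measurableSet_ball.compl) fun z => ?_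
  · refine this.congr (ae_of_all _ fun z => ?_)
    dsimp only
    by_cases hz : z ∈ (ball (0 : Rd d) δ)ᶜ
    · rw [indicator_of_mem hz, indicator_of_mem hz]
    · rw [indicator_of_notMem hz, indicator_of_notMem hz, zero_mul]
  · by_cases hz : z ∈ (ball (0 : Rd d) δ)ᶜ
    · rw [indicator_of_mem hz, div_mul_eq_mul_div, le_div_iff₀ hmin]
      have hz' : δ ≤ ‖z‖ := by simpa using hz
      exact mul_le_mul (hb z) (min_le_min le_rfl (by gcongr)) hmin.le hM
    · rw [indicator_of_notMem hz, abs_zero]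
      positivity

lemma integrableOn_sq_mul_j {δ : ℝ} (hδ : δ ≤ 1) :
    IntegrableOn (fun z : Rd d => ‖z‖ ^ 2 * S.j ‖z‖) (ball 0 δ) := by
  refine (S.integrable_min_mul_j.integrableOn (s := ball 0 δ)).congr_fun
    (fun z hz => ?_) measurableSet_ball
  have hz' : ‖z‖ < δ := by simpa using hz
  have : ‖z‖ ^ 2 ≤ 1 := pow_le_one₀ (norm_nonneg z) (hz'.le.trans hδ)
  simp only [min_eq_right this]

/-- A function that satisfies the integrated supersolution inequality with right-hand side `g`
for all paraboloids `u x + ⟪p, z⟫ - K ‖z‖ ^ 2` touching it locally from below at `x`. -/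
def SatisfiesSuperAt (u : Rd d → ℝ) (x : Rd d) (g : ℝ) : Prop :=
  ∀ (p : Rd d) (K r δ : ℝ), 0 ≤ K →
    (∀ z, ‖z‖ < r → u x + ⟪p, z⟫ - K * ‖z‖ ^ 2 ≤ u (x + z)) →
    0 < δ → δ ≤ r → δ ≤ 1 →
    g ≤ K * (∫ z in ball (0 : Rd d) δ, ‖z‖ ^ 2 * S.j ‖z‖) +
      ∫ z in (ball (0 : Rd d) δ)ᶜ, (u x - u (x + z)) * S.j ‖z‖

/-- A cut-off function that is `1` for `‖z‖ ≤ δ / 2` and `0` for `‖z‖ ≥ δ`. -/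
def cutoff (δ : ℝ) (z : Rd d) : ℝ := max 0 (min 1 (2 - 2 * ‖z‖ / δ))

lemma cutoff_nonneg (δ : ℝ) (z : Rd d) : 0 ≤ cutoff δ z := le_max_left _ _

lemma cutoff_le_one (δ : ℝ) (z : Rd d) : cutoff δ z ≤ 1 :=
  max_le zero_le_one (min_le_left _ _)

lemma continuous_cutoff (δ : ℝ) : Continuous (cutoff (d := d) δ) := by
  unfold cutoff
  fun_prop

lemma cutoff_eq_one {δ : ℝ} (hδ : 0 < δ) {z : Rd d} (hz : ‖z‖ ≤ δ / 2) : cutoff δ z = 1 := by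
  have : 2 * ‖z‖ / δ ≤ 1 := by rw [div_le_one hδ]; linarith
  unfold cutoff
  rw [min_eq_left (by linarith), max_eq_right zero_le_one]

lemma cutoff_eq_zero {δ : ℝ} (hδ : 0 < δ) {z : Rd d} (hz : δ ≤ ‖z‖) : cutoff δ z = 0 := by
  have : 2 ≤ 2 * ‖z‖ / δ := by rw [le_div_iff₀ hδ]; linarith
  unfold cutoff
  rw [max_eq_left]
  exact (min_le_right _ _).trans (by linarith)

/-- The test function obtained from `u` by gluing in the paraboloid
`u x + ⟪p, z⟫ - K ‖z‖ ^ 2` near `x` and subtracting `τ min(1, ‖z‖²)`. -/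
def gluedTest (u : Rd d → ℝ) (x p : Rd d) (K δ τ : ℝ) (y : Rd d) : ℝ :=
  u y - cutoff δ (y - x) * (u y - (u x + ⟪p, y - x⟫ - K * ‖y - x‖ ^ 2)) -
    τ * min 1 (‖y - x‖ ^ 2)

section gluedTest

variable {u : Rd d → ℝ} {x p : Rd d} {K δ τ : ℝ}

lemma gluedTest_self : gluedTest u x p K δ τ x = u x := by
  simp [gluedTest]

lemma gluedTest_eq_near (hδ : 0 < δ) (hδ1 : δ ≤ 1) {y : Rd d} (hy : y ∈ ball x (δ / 2)) :
    gluedTest u x p K δ τ y = u x + ⟪p, y - x⟫ - (K + τ) * ‖y - x‖ ^ 2 := by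
  have hy' : ‖y - x‖ < δ / 2 := by rwa [mem_ball, dist_eq_norm] at hy
  have h2 : ‖y - x‖ ^ 2 ≤ 1 := pow_le_one₀ (norm_nonneg _) (by linarith)
  rw [gluedTest, cutoff_eq_one hδ hy'.le, min_eq_right h2]
  ring

lemma gluedTest_eq_far (hδ : 0 < δ) {y : Rd d} (hy : δ ≤ ‖y - x‖) :
    gluedTest u x p K δ τ y = u y - τ * min 1 (‖y - x‖ ^ 2) := by
  rw [gluedTest, cutoff_eq_zero hδ hy]
  ring

lemma continuous_gluedTest (hu : Continuous u) : Continuous (gluedTest u x p K δ τ) := by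
  unfold gluedTest
  have := continuous_cutoff (d := d) δ
  fun_prop

lemma abs_gluedTest_le {M : ℝ} (hM : ∀ y, |u y| ≤ M) (hK : 0 ≤ K) (hτ : 0 ≤ τ) (hδ : 0 < δ)
    (hδ1 : δ ≤ 1) (y : Rd d) : |gluedTest u x p K δ τ y| ≤ M + (2 * M + ‖p‖ + K) + τ := by
  have hM0 : 0 ≤ M := (abs_nonneg _).trans (hM 0)
  have h1 : |τ * min 1 (‖y - x‖ ^ 2)| ≤ τ := by
    rw [abs_of_nonneg (by positivity)]
    exact mul_le_of_le_one_right hτ (min_le_left _ _)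
  have h2 : |cutoff δ (y - x) * (u y - (u x + ⟪p, y - x⟫ - K * ‖y - x‖ ^ 2))| ≤
      2 * M + ‖p‖ + K := by
    rcases le_or_gt δ ‖y - x‖ with h | h
    · rw [cutoff_eq_zero hδ h, zero_mul, abs_zero]; positivity
    · rw [abs_mul, abs_of_nonneg (cutoff_nonneg _ _)]
      refine (mul_le_of_le_one_left (abs_nonneg _) (cutoff_le_one _ _)).trans ?_
      have hn : ‖y - x‖ ≤ 1 := by linarith
      have h3 : |⟪p, y - x⟫| ≤ ‖p‖ :=
        (abs_real_inner_le_norm _ _).trans (mul_le_of_le_one_right (norm_nonneg _) hn)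
      have h4 : K * ‖y - x‖ ^ 2 ≤ K := mul_le_of_le_one_right hK (pow_le_one₀ (norm_nonneg _) hn)
      have h5 : 0 ≤ K * ‖y - x‖ ^ 2 := by positivity
      have h6 := abs_le.1 h3
      have h7 := abs_le.1 (hM y)
      have h8 := abs_le.1 (hM x)
      rw [abs_le]
      constructor <;> linarith
  have h3 := abs_le.1 h1
  have h4 := abs_le.1 h2
  have h5 := abs_le.1 (hM y)
  rw [gluedTest, abs_le]
  constructor <;> linarith

lemma testAt_gluedTest (hu : Continuous u) {M : ℝ} (hM : ∀ y, |u y| ≤ M) (hK : 0 ≤ K)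
    (hτ : 0 ≤ τ) (hδ : 0 < δ) (hδ1 : δ ≤ 1) : TestAt x (gluedTest u x p K δ τ) := by
  refine ⟨⟨_, abs_gluedTest_le hM hK hτ hδ hδ1⟩, continuous_gluedTest hu,
    ball x (δ / 2), ball_mem_nhds x (by linarith), ?_⟩
  refine ContDiffOn.congr (f := fun y => u x + ⟪p, y - x⟫ - (K + τ) * ‖y - x‖ ^ 2) ?_
    fun y hy => gluedTest_eq_near hδ hδ1 hy
  apply ContDiff.contDiffOn
  have h1 : ContDiff ℝ 2 fun y : Rd d => y - x := contDiff_id.sub contDiff_const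
  exact (contDiff_const.add (contDiff_const.inner ℝ h1)).sub
    (contDiff_const.mul (h1.norm_sq ℝ))

lemma gluedTest_lt {r : ℝ} (htouch : ∀ z, ‖z‖ < r → u x + ⟪p, z⟫ - K * ‖z‖ ^ 2 ≤ u (x + z))
    (hτ : 0 < τ) (hδ : 0 < δ) (hδr : δ ≤ r) {y : Rd d} (hy : y ≠ x) :
    gluedTest u x p K δ τ y < u y := by
  have hn : 0 < ‖y - x‖ := norm_pos_iff.2 (sub_ne_zero.2 hy)
  have h1 : 0 < τ * min 1 (‖y - x‖ ^ 2) := by positivity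
  rcases le_or_gt δ ‖y - x‖ with h | h
  · rw [gluedTest_eq_far hδ h]; linarith
  · have h2 := htouch (y - x) (h.trans_le hδr)
    rw [add_sub_cancel] at h2
    have h3 : 0 ≤ cutoff δ (y - x) * (u y - (u x + ⟪p, y - x⟫ - K * ‖y - x‖ ^ 2)) :=
      mul_nonneg (cutoff_nonneg _ _) (by linarith)
    rw [gluedTest]; linarith

lemma gradient_gluedTest (hδ : 0 < δ) (hδ1 : δ ≤ 1) :
    gradient (gluedTest u x p K δ τ) x = p := by
  apply HasGradientAt.gradient
  have h1 : HasGradientAt (fun y => u x + ⟪p, y - x⟫ - (K + τ) * ‖y - x‖ ^ 2) p x := by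
    rw [hasGradientAt_iff_hasFDerivAt]
    have hid : HasFDerivAt (fun y : Rd d => y - x) (ContinuousLinearMap.id ℝ (Rd d)) x :=
      (hasFDerivAt_id x).sub_const x
    have h2 := (((hasFDerivAt_const p x).inner ℝ hid).const_add (u x)).sub
      ((hid.norm_sq).const_mul (K + τ))
    refine h2.congr_fderiv ?_
    ext z
    simp
  refine h1.congr_of_eventuallyEq ?_
  filter_upwards [ball_mem_nhds x (half_pos hδ)] with y hy
  exact gluedTest_eq_near hδ hδ1 hy

end gluedTest

lemma abs_indicator_inner_le (p z : Rd d) : |if ‖z‖ ≤ 1 then ⟪z, p⟫ else 0| ≤ ‖p‖ := by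
  split_ifs with h
  · exact (abs_real_inner_le_norm _ _).trans (mul_le_of_le_one_left (norm_nonneg _) h)
  · simp

lemma measurable_indicator_inner (p : Rd d) :
    Measurable fun z : Rd d => if ‖z‖ ≤ 1 then ⟪z, p⟫ else 0 :=
  Measurable.ite (measurableSet_le measurable_norm measurable_const) (by fun_prop)
    measurable_const

lemma integrable_gluedTest {u : Rd d → ℝ} {x p : Rd d} {K δ τ : ℝ} (hu : Continuous u) {M : ℝ}
    (hM : ∀ y, |u y| ≤ M) (hK : 0 ≤ K) (hτ : 0 ≤ τ) (hδ : 0 < δ) (hδ1 : δ ≤ 1) :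
    Integrable fun z => (u x - gluedTest u x p K δ τ (x + z) +
      (if ‖z‖ ≤ 1 then ⟪z, p⟫ else 0)) * S.j ‖z‖ := by
  have hM0 : 0 ≤ M := (abs_nonneg _).trans (hM 0)
  set C₀ : ℝ := M + (M + (2 * M + ‖p‖ + K) + τ) + ‖p‖
  have hC₀ : K + τ ≤ C₀ := by simp only [C₀]; linarith [norm_nonneg p]
  have hδ2 : 0 < δ / 2 := half_pos hδ
  have hδ21 : (δ / 2) ^ 2 ≤ 1 := pow_le_one₀ hδ2.le (by linarith)
  refine S.integrable_mul_j (C := C₀ / (δ / 2) ^ 2) ?_ fun z => ?_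
  · have := (continuous_gluedTest (x := x) (p := p) (K := K) (δ := δ) (τ := τ) hu)
    exact (by fun_prop : Continuous fun z => u x - gluedTest u x p K δ τ (x + z)).measurable.add
      (measurable_indicator_inner p)
  · rw [div_mul_eq_mul_div, le_div_iff₀ (by positivity)]
    rcases lt_or_ge ‖z‖ (δ / 2) with h | h
    · have h1 : ‖z‖ ≤ 1 := by linarith
      have h2 : ‖z‖ ^ 2 ≤ 1 := pow_le_one₀ (norm_nonneg _) h1
      rw [gluedTest_eq_near hδ hδ1 (by simpa using h), if_pos h1, add_sub_cancel_left,
        real_inner_comm, min_eq_right h2]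
      have h3 : |u x - (u x + ⟪z, p⟫ - (K + τ) * ‖z‖ ^ 2) + ⟪z, p⟫| = (K + τ) * ‖z‖ ^ 2 := by
        rw [show u x - (u x + ⟪z, p⟫ - (K + τ) * ‖z‖ ^ 2) + ⟪z, p⟫ = (K + τ) * ‖z‖ ^ 2 by ring,
          abs_of_nonneg (by positivity)]
      rw [h3]
      calc (K + τ) * ‖z‖ ^ 2 * (δ / 2) ^ 2 ≤ (K + τ) * ‖z‖ ^ 2 * 1 := by gcongr
        _ = (K + τ) * ‖z‖ ^ 2 := mul_one _
        _ ≤ C₀ * ‖z‖ ^ 2 := by gcongr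
    · have hmin : (δ / 2) ^ 2 ≤ min 1 (‖z‖ ^ 2) := le_min hδ21 (by gcongr)
      have h1 : |u x - gluedTest u x p K δ τ (x + z) + (if ‖z‖ ≤ 1 then ⟪z, p⟫ else 0)| ≤ C₀ :=
        (abs_add_le _ _).trans (add_le_add ((abs_sub _ _).trans
          (add_le_add (hM x) (abs_gluedTest_le hM hK hτ hδ hδ1 _))) (abs_indicator_inner_le p z))
      have hC0 : 0 ≤ C₀ := (abs_nonneg _).trans h1
      exact mul_le_mul h1 hmin (by positivity) hC0

lemma satisfiesSuperAt_of_visc {u : Rd d → ℝ} (hu : Continuous u) {M : ℝ} (hM : ∀ y, |u y| ≤ M)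
    {x : Rd d} {g : ℝ}
    (hvisc : ∀ φ : Rd d → ℝ, TestAt x φ → φ x = u x → (∀ y, y ≠ x → φ y < u y) →
      g ≤ psiOp S φ x) : S.SatisfiesSuperAt u x g := by
  intro p K r δ hK htouch hδ hδr hδ1
  set X := K * (∫ z in ball (0 : Rd d) δ, ‖z‖ ^ 2 * S.j ‖z‖) +
      ∫ z in (ball (0 : Rd d) δ)ᶜ, (u x - u (x + z)) * S.j ‖z‖
  set C := ∫ z : Rd d, min 1 (‖z‖ ^ 2) * S.j ‖z‖
  have key : ∀ τ > 0, g ≤ X + τ * C := by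
    intro τ hτ
    refine (hvisc (gluedTest u x p K δ τ) (testAt_gluedTest hu hM hK hτ.le hδ hδ1)
      gluedTest_self fun y hy => gluedTest_lt htouch hτ hδ hδr hy).trans ?_
    rw [psiOp, gradient_gluedTest hδ hδ1, gluedTest_self]
    set a : Rd d → ℝ := (ball (0 : Rd d) δ).indicator fun z => ‖z‖ ^ 2 * S.j ‖z‖
    set b : Rd d → ℝ := (ball (0 : Rd d) δ)ᶜ.indicator fun z => (u x - u (x + z)) * S.j ‖z‖
    set c : Rd d → ℝ := (ball (0 : Rd d) δ)ᶜ.indicator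
      fun z => (if ‖z‖ ≤ 1 then ⟪z, p⟫ else 0) * S.j ‖z‖
    have ha : Integrable a := (integrable_indicator_iff measurableSet_ball).2
      (S.integrableOn_sq_mul_j hδ1)
    have hb : Integrable b := (integrable_indicator_iff measurableSet_ball.compl).2
      (S.integrableOn_mul_j_compl_ball hδ (M := M + M) (by fun_prop)
        fun z => (abs_sub _ _).trans (add_le_add (hM _) (hM _)))
    have hc : Integrable c := (integrable_indicator_iff measurableSet_ball.compl).2
      (S.integrableOn_mul_j_compl_ball hδ (measurable_indicator_inner p)
        (abs_indicator_inner_le p))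
    have hc0 : ∫ z, c z = 0 := by
      apply integral_eq_zero_of_odd
      intro z
      simp only [c, indicator, mem_compl_iff, mem_ball_zero_iff, norm_neg, inner_neg_left]
      split_ifs <;> ring
    have hab : Integrable fun z => K * a z + b z := (ha.const_mul K).add hb
    have habc : Integrable fun z => K * a z + b z + c z := hab.add hc
    have hsum : ∫ z, (K * a z + b z + c z + τ * (min 1 (‖z‖ ^ 2) * S.j ‖z‖)) = X + τ * C := by
      rw [integral_add habc (S.integrable_min_mul_j.const_mul τ),
        integral_add hab hc, integral_add (ha.const_mul K) hb, hc0,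
        integral_const_mul, integral_const_mul, integral_indicator measurableSet_ball,
        integral_indicator measurableSet_ball.compl, add_zero]
    rw [← hsum]
    refine integral_mono (S.integrable_gluedTest hu hM hK hτ.le hδ hδ1)
      (habc.add (S.integrable_min_mul_j.const_mul τ)) fun z => ?_
    simp only
    rcases lt_or_ge ‖z‖ δ with h | h
    · have hz : z ∈ ball (0 : Rd d) δ := by simpa using h
      have hz' : z ∉ (ball (0 : Rd d) δ)ᶜ := not_not.2 hz
      simp only [a, b, c, indicator_of_mem hz, indicator_of_notMem hz']
      rw [if_pos (h.le.trans hδ1), gluedTest, add_sub_cancel_left]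
      have h1 := htouch z (h.trans_le hδr)
      have h2 := mul_nonneg (sub_nonneg.2 (cutoff_le_one δ z)) (sub_nonneg.2 h1)
      have h3 : u x - (u (x + z) - cutoff δ z * (u (x + z) - (u x + ⟪p, z⟫ - K * ‖z‖ ^ 2)) -
          τ * min 1 (‖z‖ ^ 2)) + ⟪z, p⟫ ≤ K * ‖z‖ ^ 2 + τ * min 1 (‖z‖ ^ 2) := by
        rw [real_inner_comm z p] at *
        nlinarith
      have := mul_le_mul_of_nonneg_right h3 (S.j_nonneg ‖z‖)
      linarith
    · have hz : z ∈ (ball (0 : Rd d) δ)ᶜ := by simpa using h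
      have hz' : z ∉ ball (0 : Rd d) δ := hz
      simp only [a, b, c, indicator_of_mem hz, indicator_of_notMem hz']
      rw [gluedTest_eq_far hδ (by simpa using h), add_sub_cancel_left]
      apply le_of_eq
      ring
  have hlim : Tendsto (fun τ : ℝ => X + τ * C) (𝓝[>] 0) (𝓝 (X + 0 * C)) :=
    ((continuous_const.add (continuous_id.mul continuous_const)).tendsto 0).mono_left
      nhdsWithin_le_nhds
  rw [zero_mul, add_zero] at hlim
  exact ge_of_tendsto hlim (eventually_nhdsWithin_of_forall fun τ hτ => key τ hτ)

lemma integrableOn_diff_mul_j {a b : Rd d → ℝ} (ha : Measurable a) (hb : Measurable b)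
    {M c₁ c₂ : ℝ} (hM : ∀ z, |a z| ≤ M) (hM' : ∀ z, |b z| ≤ M) (hc₁ : |c₁| ≤ M) (hc₂ : |c₂| ≤ M)
    {δ : ℝ} (hδ : 0 < δ) :
    IntegrableOn (fun z => (c₁ - c₂ - (a z - b z)) * S.j ‖z‖) (ball 0 δ)ᶜ :=
  S.integrableOn_mul_j_compl_ball hδ (M := (M + M) + (M + M)) (by fun_prop) fun z =>
    (abs_sub _ _).trans (add_le_add ((abs_sub _ _).trans (add_le_add hc₁ hc₂))
      ((abs_sub _ _).trans (add_le_add (hM z) (hM' z))))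

/-- If `u` and `-w` satisfy supersolution inequalities at `x` and `y`, then so does the difference
`z ↦ u (x + z) - w (y + z)`, with the paraboloid opening of the difference only. -/
lemma sub_le_of_touching (hd : 0 < d) {u w : Rd d → ℝ} (hu : Continuous u) (hw : Continuous w)
    {M : ℝ} (huM : ∀ y, |u y| ≤ M) (hwM : ∀ y, |w y| ≤ M) {x y : Rd d} {g h : ℝ}
    (hsup : S.SatisfiesSuperAt u x g) (hsub : S.SatisfiesSuperAt (fun y => -w y) y (-h))
    {p p' q : Rd d} {K K' η r ρ : ℝ} (hK : 0 ≤ K) (hK' : 0 ≤ K') (hη : 0 ≤ η)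
    (htu : ∀ z, ‖z‖ < r → u x + ⟪p, z⟫ - K * ‖z‖ ^ 2 ≤ u (x + z))
    (htw : ∀ z, ‖z‖ < r → -w y + ⟪p', z⟫ - K' * ‖z‖ ^ 2 ≤ -w (y + z))
    (ht : ∀ z, ‖z‖ < r → u x - w y + ⟪q, z⟫ - η * ‖z‖ ^ 2 ≤ u (x + z) - w (y + z))
    (hρ : 0 < ρ) (hρr : ρ ≤ r) (hρ1 : ρ ≤ 1) :
    g - h ≤ η * (∫ z in ball (0 : Rd d) ρ, ‖z‖ ^ 2 * S.j ‖z‖) +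
      ∫ z in (ball (0 : Rd d) ρ)ᶜ, (u x - w y - (u (x + z) - w (y + z))) * S.j ‖z‖ := by
  set B : Rd d → ℝ := fun z => (u x - w y - (u (x + z) - w (y + z))) * S.j ‖z‖ with hB
  have hBint : ∀ {δ : ℝ}, 0 < δ → IntegrableOn B (ball 0 δ)ᶜ := fun hδ =>
    S.integrableOn_diff_mul_j (a := fun z => u (x + z)) (b := fun z => w (y + z))
      (by fun_prop) (by fun_prop) (fun z => huM _) (fun z => hwM _) (huM x) (hwM y) hδ
  have key : ∀ δ : ℝ, 0 < δ → δ ≤ ρ →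
      g - h ≤ (K + K') * (∫ z in ball (0 : Rd d) δ, ‖z‖ ^ 2 * S.j ‖z‖) +
        (η * (∫ z in ball (0 : Rd d) ρ, ‖z‖ ^ 2 * S.j ‖z‖) +
          ∫ z in (ball (0 : Rd d) ρ)ᶜ, B z) := by
    intro δ hδ hδρ
    have h1 := hsup p K r δ hK htu hδ (hδρ.trans hρr) (hδρ.trans hρ1)
    have h2 := hsub p' K' r δ hK' htw hδ (hδρ.trans hρr) (hδρ.trans hρ1)
    have hu1 : IntegrableOn (fun z => (u x - u (x + z)) * S.j ‖z‖) (ball 0 δ)ᶜ :=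
      S.integrableOn_mul_j_compl_ball hδ (M := M + M) (by fun_prop)
        fun z => (abs_sub _ _).trans (add_le_add (huM _) (huM _))
    have hw1 : IntegrableOn (fun z => (-w y - -w (y + z)) * S.j ‖z‖) (ball 0 δ)ᶜ :=
      S.integrableOn_mul_j_compl_ball hδ (M := M + M) (by fun_prop)
        fun z => (abs_sub _ _).trans (by rw [abs_neg, abs_neg]; exact add_le_add (hwM _) (hwM _))
    have hsum : (∫ z in (ball (0 : Rd d) δ)ᶜ, (u x - u (x + z)) * S.j ‖z‖) +
        ∫ z in (ball (0 : Rd d) δ)ᶜ, (-w y - -w (y + z)) * S.j ‖z‖ =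
        ∫ z in (ball (0 : Rd d) δ)ᶜ, B z := by
      rw [← integral_add hu1 hw1]
      congr 1
      ext z
      simp only [hB]
      ring
    have h3 : ∫ z in (ball (0 : Rd d) δ)ᶜ, B z ≤
        η * (∫ z in ball (0 : Rd d) ρ, ‖z‖ ^ 2 * S.j ‖z‖) + ∫ z in (ball (0 : Rd d) ρ)ᶜ, B z := by
      set a : Rd d → ℝ := (ball (0 : Rd d) ρ).indicator fun z => ‖z‖ ^ 2 * S.j ‖z‖
      set b : Rd d → ℝ := (ball (0 : Rd d) ρ)ᶜ.indicator B
      set c : Rd d → ℝ := (ball (0 : Rd d) δ)ᶜ.indicator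
        fun z => (if ‖z‖ < ρ then ⟪z, q⟫ else 0) * S.j ‖z‖
      have ha : Integrable a := (integrable_indicator_iff measurableSet_ball).2
        (S.integrableOn_sq_mul_j hρ1)
      have hb : Integrable b := (integrable_indicator_iff measurableSet_ball.compl).2 (hBint hρ)
      have hc : Integrable c := (integrable_indicator_iff measurableSet_ball.compl).2 <| by
        refine S.integrableOn_mul_j_compl_ball hδ (M := ‖q‖)
          (Measurable.ite (measurableSet_lt measurable_norm measurable_const) (by fun_prop)
            measurable_const) fun z => ?_
        split_ifs with hz
        · exact (abs_real_inner_le_norm _ _).trans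
            (mul_le_of_le_one_left (norm_nonneg _) (hz.le.trans hρ1))
        · simp
      have hc0 : ∫ z, c z = 0 := by
        apply integral_eq_zero_of_odd
        intro z
        simp only [c, indicator, mem_compl_iff, mem_ball_zero_iff, norm_neg, inner_neg_left]
        split_ifs <;> ring
      have hab : Integrable fun z => η * a z + b z := (ha.const_mul η).add hb
      have hval : ∫ z, (η * a z + b z - c z) =
          η * (∫ z in ball (0 : Rd d) ρ, ‖z‖ ^ 2 * S.j ‖z‖) +
            ∫ z in (ball (0 : Rd d) ρ)ᶜ, B z := by
        rw [integral_sub hab hc, integral_add (ha.const_mul η) hb, hc0, integral_const_mul,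
          integral_indicator measurableSet_ball, integral_indicator measurableSet_ball.compl,
          sub_zero]
      rw [← hval, ← integral_indicator measurableSet_ball.compl]
      refine integral_mono ((integrable_indicator_iff measurableSet_ball.compl).2 (hBint hδ))
        (hab.sub hc) fun z => ?_
      simp only [a, b, c, indicator, mem_compl_iff, mem_ball_zero_iff, not_lt]
      rcases lt_or_ge ‖z‖ δ with hz | hz
      · have hzρ : ‖z‖ < ρ := hz.trans_le hδρ
        rw [if_neg (not_le.2 hz), if_pos hzρ, if_neg (not_le.2 hzρ), if_neg (not_le.2 hz)]
        have := mul_nonneg hη (mul_nonneg (sq_nonneg ‖z‖) (S.j_nonneg ‖z‖))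
        linarith
      · rw [if_pos hz, if_pos hz]
        rcases lt_or_ge ‖z‖ ρ with hzρ | hzρ
        · rw [if_pos hzρ, if_neg (not_le.2 hzρ), if_pos hzρ]
          have h4 := ht z (hzρ.trans_le hρr)
          rw [real_inner_comm] at h4
          have := mul_le_mul_of_nonneg_right
            (by linarith : u x - w y - (u (x + z) - w (y + z)) ≤ η * ‖z‖ ^ 2 - ⟪z, q⟫)
            (S.j_nonneg ‖z‖)
          simp only [hB]
          linarith
        · rw [if_neg (not_lt.2 hzρ), if_pos hzρ, if_neg (not_lt.2 hzρ)]
          simp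
    linarith
  have hlim := tendsto_setIntegral_ball_zero hd (S.integrableOn_sq_mul_j le_rfl)
  have hlim2 := (hlim.const_mul (K + K')).add_const
    (η * (∫ z in ball (0 : Rd d) ρ, ‖z‖ ^ 2 * S.j ‖z‖) + ∫ z in (ball (0 : Rd d) ρ)ᶜ, B z)
  rw [mul_zero, zero_add] at hlim2
  refine ge_of_tendsto hlim2 ?_
  filter_upwards [tendsto_one_div_add_atTop_nhds_zero_nat.eventually_le_const hρ] with n hn
  exact key _ (by positivity) hn

/-- Doubling of variables: at a local minimum of `u - w` at which `u` is a supersolution and `w`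
a subsolution nearby, the difference satisfies the supersolution inequality. -/
lemma sub_le_setIntegral_of_isLocalMin (hd : 0 < d) {u w : Rd d → ℝ} (hu : Continuous u)
    (hw : UniformContinuous w) {M : ℝ} (huM : ∀ y, |u y| ≤ M) (hwM : ∀ y, |w y| ≤ M)
    {x₀ : Rd d} {r ρ : ℝ} {g h : Rd d → ℝ}
    (hsup : ∀ x ∈ ball x₀ r, S.SatisfiesSuperAt u x (g x))
    (hsub : ∀ y ∈ ball x₀ r, S.SatisfiesSuperAt (fun y => -w y) y (-h y))
    (hmin : ∀ x ∈ ball x₀ r, u x₀ - w x₀ ≤ u x - w x)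
    (hg : ContinuousAt g x₀) (hh : ContinuousAt h x₀)
    (hρ : 0 < ρ) (hρ1 : ρ ≤ 1) (hρr : ρ ≤ r / 4) :
    g x₀ - h x₀ ≤
      ∫ z in (ball (0 : Rd d) ρ)ᶜ, (u x₀ - w x₀ - (u (x₀ + z) - w (x₀ + z))) * S.j ‖z‖ := by
  have hr : 0 < r := by linarith
  set I := ∫ z in ball (0 : Rd d) ρ, ‖z‖ ^ 2 * S.j ‖z‖
  have key : ∀ η > 0, g x₀ - h x₀ ≤ η * I +
      ∫ z in (ball (0 : Rd d) ρ)ᶜ, (u x₀ - w x₀ - (u (x₀ + z) - w (x₀ + z))) * S.j ‖z‖ := by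
    intro η hη
    have hex : ∀ n : ℕ, ∃ P : Rd d × Rd d,
        P ∈ closedBall x₀ (r / 2) ×ˢ closedBall x₀ (r / 2) ∧
        IsMinOn (fun P : Rd d × Rd d => u P.1 - w P.2 + ((n : ℝ) + 1) * ‖P.1 - P.2‖ ^ 2 +
          η * ‖P.1 - x₀‖ ^ 2) (closedBall x₀ (r / 2) ×ˢ closedBall x₀ (r / 2)) P := by
      intro n
      have hw' := hw.continuous
      exact ((isCompact_closedBall _ _).prod (isCompact_closedBall _ _)).exists_isMinOn
        ⟨(x₀, x₀), by simpa using (half_pos hr).le⟩ (by fun_prop)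
    choose P hPmem hPmin using hex
    have hx0 : x₀ ∈ closedBall x₀ (r / 2) := mem_closedBall_self (by linarith)
    have hcmp : ∀ n, u (P n).1 - w (P n).2 + ((n : ℝ) + 1) * ‖(P n).1 - (P n).2‖ ^ 2 +
        η * ‖(P n).1 - x₀‖ ^ 2 ≤ u x₀ - w x₀ := by
      intro n
      have := isMinOn_iff.1 (hPmin n) (x₀, x₀) ⟨hx0, hx0⟩
      simpa using this
    have hM0 : 0 ≤ M := (abs_nonneg _).trans (huM 0)
    have hdist : Tendsto (fun n => dist (P n).1 (P n).2) atTop (𝓝 0) := by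
      have h1 : Tendsto (fun n => ‖(P n).1 - (P n).2‖ ^ 2) atTop (𝓝 0) := by
        have h2 : Tendsto (fun n : ℕ => 4 * M * (1 / ((n : ℝ) + 1))) atTop (𝓝 (4 * M * 0)) :=
          tendsto_one_div_add_atTop_nhds_zero_nat.const_mul _
        rw [mul_zero] at h2
        refine squeeze_zero (fun n => by positivity) (fun n => ?_) h2
        rw [mul_one_div, le_div_iff₀ (by positivity)]
        have h3 := hcmp n
        have h4 : 0 ≤ η * ‖(P n).1 - x₀‖ ^ 2 := by positivity
        have := abs_le.1 (huM (P n).1)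
        have := abs_le.1 (huM x₀)
        have := abs_le.1 (hwM (P n).2)
        have := abs_le.1 (hwM x₀)
        linarith
      have h2 := h1.sqrt
      rw [Real.sqrt_zero] at h2
      refine h2.congr fun n => ?_
      rw [Real.sqrt_sq (norm_nonneg _), dist_eq_norm]
    have hwdist : Tendsto (fun n => dist (w (P n).1) (w (P n).2)) atTop (𝓝 0) := by
      exact tendsto_uniformity_iff_dist_tendsto_zero.1
        (Tendsto.comp hw (tendsto_uniformity_iff_dist_tendsto_zero.2 hdist))
    have hxlim : Tendsto (fun n => (P n).1) atTop (𝓝 x₀) := by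
      rw [tendsto_iff_norm_sub_tendsto_zero]
      have h1 : Tendsto (fun n => ‖(P n).1 - x₀‖ ^ 2) atTop (𝓝 0) := by
        have h2 := hwdist.const_mul (1 / η)
        rw [mul_zero] at h2
        refine squeeze_zero (fun n => by positivity) (fun n => ?_) h2
        rw [one_div_mul_eq_div, le_div_iff₀ hη]
        have h3 := hcmp n
        have h4 := hmin _ (closedBall_subset_ball (by linarith) (hPmem n).1)
        have h5 : 0 ≤ ((n : ℝ) + 1) * ‖(P n).1 - (P n).2‖ ^ 2 := by positivity
        have h6 := neg_abs_le (w (P n).1 - w (P n).2)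
        rw [Real.dist_eq]
        linarith
      have h2 := h1.sqrt
      rw [Real.sqrt_zero] at h2
      refine h2.congr fun n => ?_
      rw [Real.sqrt_sq (norm_nonneg _)]
    have hylim : Tendsto (fun n => (P n).2) atTop (𝓝 x₀) := by
      rw [tendsto_iff_dist_tendsto_zero]
      have h1 := hdist.add (tendsto_iff_dist_tendsto_zero.1 hxlim)
      rw [add_zero] at h1
      refine squeeze_zero (fun n => dist_nonneg) (fun n => ?_) h1
      rw [dist_comm (P n).1 (P n).2]
      exact dist_triangle _ _ _
    have hev : ∀ᶠ n in atTop, g (P n).1 - h (P n).2 ≤ η * I +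
        ∫ z in (ball (0 : Rd d) ρ)ᶜ,
          (u (P n).1 - w (P n).2 - (u ((P n).1 + z) - w ((P n).2 + z))) * S.j ‖z‖ := by
      have hr4 : 0 < r / 4 := by linarith
      filter_upwards [hxlim.eventually (ball_mem_nhds _ hr4),
        hylim.eventually (ball_mem_nhds _ hr4)] with n hxn hyn
      set x := (P n).1
      set y := (P n).2
      have hmem : ∀ {a z : Rd d}, a ∈ ball x₀ (r / 4) → ‖z‖ < r / 4 →
          a + z ∈ closedBall x₀ (r / 2) := by
        intro a z ha hz
        rw [mem_ball, dist_eq_norm] at ha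
        rw [mem_closedBall, dist_eq_norm, add_sub_right_comm]
        exact (norm_add_le _ _).trans (by linarith)
      have hxm : x ∈ closedBall x₀ (r / 2) := (hPmem n).1
      have hym : y ∈ closedBall x₀ (r / 2) := (hPmem n).2
      have hM1 : ∀ a ∈ closedBall x₀ (r / 2), ∀ b ∈ closedBall x₀ (r / 2),
          u x - w y + ((n : ℝ) + 1) * ‖x - y‖ ^ 2 + η * ‖x - x₀‖ ^ 2 ≤
          u a - w b + ((n : ℝ) + 1) * ‖a - b‖ ^ 2 + η * ‖a - x₀‖ ^ 2 := fun a ha b hb =>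
        isMinOn_iff.1 (hPmin n) (a, b) ⟨ha, hb⟩
      have hsq : ∀ a z : Rd d, ‖a + z‖ ^ 2 = ‖a‖ ^ 2 + 2 * ⟪a, z⟫ + ‖z‖ ^ 2 := fun a z =>
        norm_add_sq_real a z
      refine S.sub_le_of_touching hd hu hw.continuous huM hwM
        (hsup x (ball_subset_ball (by linarith) hxn)) (hsub y (ball_subset_ball (by linarith) hyn))
        (p := -(2 * ((n : ℝ) + 1)) • (x - y) - (2 * η) • (x - x₀))
        (p' := (2 * ((n : ℝ) + 1)) • (x - y)) (q := -(2 * η) • (x - x₀))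
        (K := (n : ℝ) + 1 + η) (K' := (n : ℝ) + 1) (η := η) (r := r / 4)
        (by positivity) (by positivity) hη.le ?_ ?_ ?_ hρ hρr hρ1
      · intro z hz
        have h1 := hM1 _ (hmem hxn hz) _ hym
        rw [add_sub_right_comm x z y, add_sub_right_comm x z x₀, hsq, hsq] at h1
        rw [inner_sub_left, real_inner_smul_left, real_inner_smul_left]
        linarith
      · intro z hz
        have h1 := hM1 _ hxm _ (hmem hyn hz)
        rw [← sub_sub, sub_eq_add_neg (x - y) z, hsq, inner_neg_right, norm_neg] at h1
        rw [real_inner_smul_left]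
        linarith
      · intro z hz
        have h1 := hM1 _ (hmem hxn hz) _ (hmem hyn hz)
        rw [add_sub_add_right_eq_sub, add_sub_right_comm x z x₀, hsq] at h1
        rw [real_inner_smul_left]
        linarith
    have hlimL : Tendsto (fun n => g (P n).1 - h (P n).2) atTop (𝓝 (g x₀ - h x₀)) :=
      (hg.tendsto.comp hxlim).sub (hh.tendsto.comp hylim)
    have hlimR : Tendsto (fun n => ∫ z in (ball (0 : Rd d) ρ)ᶜ,
        (u (P n).1 - w (P n).2 - (u ((P n).1 + z) - w ((P n).2 + z))) * S.j ‖z‖) atTop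
        (𝓝 (∫ z in (ball (0 : Rd d) ρ)ᶜ,
          (u x₀ - w x₀ - (u (x₀ + z) - w (x₀ + z))) * S.j ‖z‖)) := by
      have hw' := hw.continuous
      refine tendsto_integral_of_dominated_convergence
        (fun z : Rd d => ((M + M) + (M + M)) * S.j ‖z‖) (fun n => ?_) ?_ (fun n => ?_) ?_
      · exact (S.integrableOn_diff_mul_j (a := fun z => u ((P n).1 + z))
          (b := fun z => w ((P n).2 + z)) (by fun_prop) (by fun_prop) (fun z => huM _)
          (fun z => hwM _) (huM _) (hwM _) hρ).1
      · exact S.integrableOn_mul_j_compl_ball hρ (h := fun _ => (M + M) + (M + M))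
          measurable_const (fun _ => le_rfl)
      · refine ae_of_all _ fun z => ?_
        rw [norm_mul, Real.norm_eq_abs, Real.norm_of_nonneg (S.j_nonneg _)]
        refine mul_le_mul_of_nonneg_right ?_ (S.j_nonneg _)
        exact (abs_sub _ _).trans (add_le_add ((abs_sub _ _).trans (add_le_add (huM _) (hwM _)))
          ((abs_sub _ _).trans (add_le_add (huM _) (hwM _))))
      · refine ae_of_all _ fun z => ?_
        have e1 := (hu.tendsto x₀).comp hxlim
        have e2 := (hw'.tendsto x₀).comp hylim
        have e3 := (hu.tendsto (x₀ + z)).comp (hxlim.add_const z)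
        have e4 := (hw'.tendsto (x₀ + z)).comp (hylim.add_const z)
        exact ((e1.sub e2).sub (e3.sub e4)).mul_const _
    exact le_of_tendsto_of_tendsto hlimL (hlimR.const_add _) hev
  have hlim : Tendsto (fun η : ℝ => η * I +
      ∫ z in (ball (0 : Rd d) ρ)ᶜ, (u x₀ - w x₀ - (u (x₀ + z) - w (x₀ + z))) * S.j ‖z‖)
      (𝓝[>] 0) (𝓝 (0 * I +
      ∫ z in (ball (0 : Rd d) ρ)ᶜ, (u x₀ - w x₀ - (u (x₀ + z) - w (x₀ + z))) * S.j ‖z‖)) :=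
    (((continuous_id.mul continuous_const).add continuous_const).tendsto 0).mono_left
      nhdsWithin_le_nhds
  rw [zero_mul, zero_add] at hlim
  exact ge_of_tendsto hlim (eventually_nhdsWithin_of_forall fun η hη => key η hη)

end PsiSetting

section Reflection

variable {d : ℕ} {e : Rd d} {μ : ℝ}

/-- The linear part of `reflAt`. -/
def linRefl (e : Rd d) : Rd d ≃ₗᵢ[ℝ] Rd d := (ℝ ∙ e)ᗮ.reflection

lemma linRefl_apply (he : ‖e‖ = 1) (x : Rd d) : linRefl e x = x - (2 * ⟪x, e⟫) • e := by
  rw [linRefl, Submodule.reflection_orthogonal_apply, Submodule.reflection_singleton_apply, he,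
    real_inner_comm]
  simp only [RCLike.ofReal_real_eq_id, id, one_pow, div_one, neg_sub, mul_smul, two_smul]

lemma reflAt_eq (he : ‖e‖ = 1) (x : Rd d) : reflAt e μ x = linRefl e x + (2 * μ) • e := by
  rw [reflAt, linRefl_apply he, sub_smul]
  abel

lemma reflAt_add (he : ‖e‖ = 1) (x z : Rd d) :
    reflAt e μ (x + z) = reflAt e μ x + linRefl e z := by
  rw [reflAt_eq he, reflAt_eq he, map_add]
  abel

lemma inner_reflAt (he : ‖e‖ = 1) (x : Rd d) : ⟪reflAt e μ x, e⟫ = 2 * μ - ⟪x, e⟫ := by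
  rw [reflAt, inner_sub_left, real_inner_smul_left, real_inner_self_eq_norm_sq, he]
  ring

lemma reflAt_reflAt (he : ‖e‖ = 1) (x : Rd d) : reflAt e μ (reflAt e μ x) = x := by
  rw [reflAt, inner_reflAt he, reflAt]
  module

lemma continuous_reflAt : Continuous fun p : ℝ × Rd d => reflAt e p.1 p.2 := by
  unfold reflAt
  fun_prop

/-- The reflection across a hyperplane, as a homeomorphism. -/
def reflAtHomeomorph (he : ‖e‖ = 1) (μ : ℝ) : Rd d ≃ₜ Rd d where
  toFun := reflAt e μ
  invFun := reflAt e μ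
  left_inv := reflAt_reflAt he
  right_inv := reflAt_reflAt he
  continuous_toFun := continuous_reflAt.comp (Continuous.prodMk_right μ)
  continuous_invFun := continuous_reflAt.comp (Continuous.prodMk_right μ)

lemma measurePreserving_reflAt (he : ‖e‖ = 1) (μ : ℝ) :
    MeasurePreserving (reflAt e μ) (volume : Measure (Rd d)) volume := by
  have h : reflAt e μ = (fun x => x + (2 * μ) • e) ∘ linRefl e := by
    ext1 x; exact reflAt_eq he x
  rw [h]
  exact (measurePreserving_add_right _ _).comp (linRefl e).measurePreserving

lemma reflAt_of_inner_eq {x : Rd d} (hx : ⟪x, e⟫ = μ) : reflAt e μ x = x := by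
  rw [reflAt, hx, sub_self, zero_smul, sub_zero]

lemma norm_reflAt_sub_sq (he : ‖e‖ = 1) (x y : Rd d) : ‖reflAt e μ y - x‖ ^ 2 =
    ‖y - x‖ ^ 2 + 4 * (μ - ⟪y, e⟫) * (μ - ⟪x, e⟫) := by
  have h : reflAt e μ y - x = (y - x) + (2 * (μ - ⟪y, e⟫)) • e := by
    rw [reflAt]
    module
  rw [h, norm_add_sq_real, norm_smul, he, real_inner_smul_right, inner_sub_left, Real.norm_eq_abs,
    mul_one, sq_abs]
  ring

lemma norm_sub_le_norm_reflAt_sub (he : ‖e‖ = 1) {x y : Rd d} (hx : ⟪x, e⟫ ≤ μ)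
    (hy : ⟪y, e⟫ ≤ μ) : ‖y - x‖ ≤ ‖reflAt e μ y - x‖ := by
  have h := norm_reflAt_sub_sq (μ := μ) he x y
  have := mul_nonneg (sub_nonneg.2 hx) (sub_nonneg.2 hy)
  exact le_of_sq_le_sq (by linarith) (norm_nonneg _)

lemma norm_sub_lt_norm_reflAt_sub (he : ‖e‖ = 1) {x y : Rd d} (hx : ⟪x, e⟫ < μ)
    (hy : ⟪y, e⟫ < μ) : ‖y - x‖ < ‖reflAt e μ y - x‖ := by
  have h := norm_reflAt_sub_sq (μ := μ) he x y
  have := mul_pos (sub_pos.2 hx) (sub_pos.2 hy)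
  exact lt_of_pow_lt_pow_left₀ 2 (norm_nonneg _) (by linarith)

lemma inner_sub_le_norm (he : ‖e‖ = 1) (x y : Rd d) : ⟪y, e⟫ - ⟪x, e⟫ ≤ ‖y - x‖ := by
  have := real_inner_le_norm (y - x) e
  rwa [he, mul_one, inner_sub_left] at this

end Reflection

namespace PsiSetting

variable {d : ℕ} (S : PsiSetting d) {e : Rd d}

lemma SatisfiesSuperAt.comp_reflAt (he : ‖e‖ = 1) (μ : ℝ) {u : Rd d → ℝ} {y : Rd d} {g : ℝ}
    (h : S.SatisfiesSuperAt u (reflAt e μ y) g) :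
    S.SatisfiesSuperAt (fun x => u (reflAt e μ x)) y g := by
  intro p K r δ hK htouch hδ hδr hδ1
  refine (h (linRefl e p) K r δ hK (fun z hz => ?_) hδ hδr hδ1).trans_eq ?_
  · have h1 := htouch ((linRefl e).symm z) (by rwa [LinearIsometryEquiv.norm_map])
    dsimp only at h1
    rw [reflAt_add he, LinearIsometryEquiv.apply_symm_apply, LinearIsometryEquiv.norm_map,
      ← (linRefl e).inner_map_map, LinearIsometryEquiv.apply_symm_apply] at h1
    exact h1
  · congr 1
    have h1 := (linRefl e).measurePreserving.setIntegral_preimage_emb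
      (linRefl e).toHomeomorph.measurableEmbedding
      (fun z => (u (reflAt e μ y) - u (reflAt e μ y + z)) * S.j ‖z‖) (ball (0 : Rd d) δ)ᶜ
    rw [← h1]
    have h2 : linRefl e ⁻¹' (ball (0 : Rd d) δ)ᶜ = (ball (0 : Rd d) δ)ᶜ := by
      ext z; simp
    rw [h2]
    simp only [reflAt_add he, LinearIsometryEquiv.norm_map]

/-- If an antisymmetric function attains a nonpositive minimum over the half-space at an interior
point and satisfies the supersolution inequality there, then it vanishes in the half-space. -/
lemma eq_zero_of_antisymm (hd : 0 < d) (he : ‖e‖ = 1) {μ : ℝ} {v : Rd d → ℝ} (hv : Continuous v)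
    {M : ℝ} (hM : ∀ y, |v y| ≤ M) (hanti : ∀ y, v (reflAt e μ y) = -v y) {x₀ : Rd d}
    (hx₀ : ⟪x₀, e⟫ < μ) (hneg : v x₀ ≤ 0) (hmin : ∀ y, ⟪y, e⟫ < μ → v x₀ ≤ v y)
    {ρ₀ : ℝ} (hρ₀ : 0 < ρ₀)
    (hint : ∀ ρ, 0 < ρ → ρ ≤ ρ₀ →
      0 ≤ ∫ z in (ball (0 : Rd d) ρ)ᶜ, (v x₀ - v (x₀ + z)) * S.j ‖z‖) :
    ∀ y, ⟪y, e⟫ < μ → v y = 0 := by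
  have hplane : ∀ y, ⟪y, e⟫ = μ → v y = 0 := by
    intro y hy
    have := hanti y
    rw [reflAt_of_inner_eq hy] at this
    linarith
  have hmin' : ∀ y, ⟪y, e⟫ ≤ μ → v x₀ ≤ v y := by
    intro y hy
    rcases hy.lt_or_eq with h | h
    · exact hmin y h
    · rw [hplane y h]; exact hneg
  suffices hconst : ∀ y, ⟪y, e⟫ < μ → v y ≤ v x₀ by
    have hconst' : ∀ y, ⟪y, e⟫ < μ → v y = v x₀ := fun y hy => le_antisymm (hconst y hy) (hmin y hy)
    have hτ : 0 < μ - ⟪x₀, e⟫ := sub_pos.2 hx₀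
    have hline : ∀ t : ℝ, ⟪x₀ + t • e, e⟫ = ⟪x₀, e⟫ + t := fun t => by
      rw [inner_add_left, real_inner_smul_left, real_inner_self_eq_norm_sq, he]; ring
    have hclosed : IsClosed {t : ℝ | v (x₀ + t • e) = v x₀} :=
      isClosed_eq (by fun_prop) continuous_const
    have hsub : Set.Iio (μ - ⟪x₀, e⟫) ⊆ {t : ℝ | v (x₀ + t • e) = v x₀} := fun t ht =>
      hconst' _ (by rw [hline]; linarith [mem_Iio.1 ht])
    have hmem : μ - ⟪x₀, e⟫ ∈ {t : ℝ | v (x₀ + t • e) = v x₀} := by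
      apply closure_minimal hsub hclosed
      rw [closure_Iio]
      exact mem_Iic.2 le_rfl
    have h0 : v x₀ = 0 := by
      rw [← (show v (x₀ + (μ - ⟪x₀, e⟫) • e) = v x₀ from hmem)]
      exact hplane _ (by rw [hline]; ring)
    intro y hy
    rw [hconst' y hy, h0]
  by_contra hcon
  push Not at hcon
  obtain ⟨y₁, hy₁, hvy₁⟩ := hcon
  have hne : y₁ ≠ x₀ := by rintro rfl; exact lt_irrefl _ hvy₁
  set τ := μ - ⟪x₀, e⟫ with hτ
  have hτ0 : 0 < τ := sub_pos.2 hx₀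
  have hM0 : 0 ≤ M := (abs_nonneg _).trans (hM 0)
  set T := reflAt e μ
  have hTT : ∀ y, T (T y) = y := reflAt_reflAt he
  have hTcont : Continuous T := (reflAtHomeomorph he μ).continuous
  set a : ℝ → Rd d → ℝ := fun ρ => (ball x₀ ρ)ᶜ.indicator fun y => (v x₀ - v y) * S.j ‖y - x₀‖
    with ha
  have ha_mem : ∀ {ρ y}, ρ ≤ ‖y - x₀‖ → a ρ y = (v x₀ - v y) * S.j ‖y - x₀‖ := fun h =>
    indicator_of_mem (by simpa [dist_eq_norm] using h) _
  have ha_notMem : ∀ {ρ y}, ‖y - x₀‖ < ρ → a ρ y = 0 := fun h =>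
    indicator_of_notMem (by simpa [dist_eq_norm] using h) _
  have hshift : ∀ ρ, (fun z => a ρ (x₀ + z)) =
      (ball (0 : Rd d) ρ)ᶜ.indicator fun z => (v x₀ - v (x₀ + z)) * S.j ‖z‖ := by
    intro ρ
    ext z
    simp [ha, indicator, dist_eq_norm]
  have ha_int : ∀ ρ, 0 < ρ → Integrable (a ρ) := by
    intro ρ hρ
    rw [← (measurePreserving_add_left volume x₀).integrable_comp_emb
      (Homeomorph.addLeft x₀).measurableEmbedding]
    have : a ρ ∘ (fun z => x₀ + z) = fun z => a ρ (x₀ + z) := rfl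
    rw [this, hshift, integrable_indicator_iff measurableSet_ball.compl]
    exact S.integrableOn_mul_j_compl_ball hρ (M := M + M) (by fun_prop)
      fun z => (abs_sub _ _).trans (add_le_add (hM _) (hM _))
  have ha_nonneg : ∀ ρ, 0 < ρ → ρ ≤ ρ₀ → 0 ≤ ∫ y, a ρ y := by
    intro ρ hρ hρ'
    rw [← integral_add_left_eq_self (a ρ) x₀, hshift, integral_indicator measurableSet_ball.compl]
    exact hint ρ hρ hρ'
  set s : ℝ → Rd d → ℝ := fun ρ y => a ρ y + a ρ (T y) with hs
  have hT_emb : MeasurableEmbedding T := (reflAtHomeomorph he μ).measurableEmbedding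
  have haT_int : ∀ ρ, 0 < ρ → Integrable fun y => a ρ (T y) := fun ρ hρ =>
    ((measurePreserving_reflAt he μ).integrable_comp_emb hT_emb).2 (ha_int ρ hρ)
  have hs_int : ∀ ρ, 0 < ρ → Integrable (s ρ) := fun ρ hρ => (ha_int ρ hρ).add (haT_int ρ hρ)
  have hs_nonneg : ∀ ρ, 0 < ρ → ρ ≤ ρ₀ → 0 ≤ ∫ y, s ρ y := by
    intro ρ hρ hρ'
    have h1 : ∫ y, s ρ y = (∫ y, a ρ y) + ∫ y, a ρ (T y) :=
      integral_add (ha_int ρ hρ) (haT_int ρ hρ)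
    rw [h1, (measurePreserving_reflAt he μ).integral_comp hT_emb]
    linarith [ha_nonneg ρ hρ hρ']
  have hs_symm : ∀ ρ y, s ρ (T y) = s ρ y := fun ρ y => by
    simp only [hs, hTT, add_comm]
  set C₀ := 2 * M * S.j τ
  have hC₀ : 0 ≤ C₀ := mul_nonneg (by linarith) (S.j_nonneg _)
  have hsplit : ∀ {ρ y}, 0 < ρ → ⟪y, e⟫ ≤ μ → ρ ≤ ‖y - x₀‖ → s ρ y =
      (v x₀ - v y) * (S.j ‖y - x₀‖ - S.j ‖T y - x₀‖) + 2 * v x₀ * S.j ‖T y - x₀‖ := by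
    intro ρ y hρ hy hyρ
    simp only [hs]
    rw [ha_mem hyρ, ha_mem (hyρ.trans (norm_sub_le_norm_reflAt_sub he hx₀.le hy)), hanti]
    ring
  have hj_le : ∀ {y}, ⟪y, e⟫ ≤ μ → 0 < ‖y - x₀‖ → S.j ‖T y - x₀‖ ≤ S.j ‖y - x₀‖ := by
    intro y hy hpos
    have h1 := norm_sub_le_norm_reflAt_sub he hx₀.le hy
    exact S.j_strictAntiOn.antitoneOn hpos (hpos.trans_le h1) h1
  have hs_nonpos : ∀ {ρ y}, 0 < ρ → ⟪y, e⟫ ≤ μ → ρ ≤ ‖y - x₀‖ → s ρ y ≤ 0 := by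
    intro ρ y hρ hy hyρ
    rw [hsplit hρ hy hyρ]
    have h1 := mul_nonneg (sub_nonneg.2 (hmin' y hy))
      (sub_nonneg.2 (hj_le hy (hρ.trans_le hyρ)))
    have h2 := mul_nonneg (neg_nonneg.2 hneg) (S.j_nonneg ‖T y - x₀‖)
    linarith
  have hs_le : ∀ {ρ y}, 0 < ρ → ρ ≤ τ → ⟪y, e⟫ ≤ μ →
      s ρ y ≤ (ball x₀ ρ).indicator (fun _ => C₀) y := by
    intro ρ y hρ hρτ hy
    rcases lt_or_ge ‖y - x₀‖ ρ with h | h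
    · have hτT : τ ≤ ‖T y - x₀‖ := by
        refine le_trans ?_ (inner_sub_le_norm he x₀ (T y))
        rw [inner_reflAt he]
        linarith
      rw [indicator_of_mem (by simpa [dist_eq_norm] using h)]
      simp only [hs]
      rw [ha_notMem h, ha_mem (hρτ.trans hτT), hanti, zero_add]
      have h1 : S.j ‖T y - x₀‖ ≤ S.j τ :=
        S.j_strictAntiOn.antitoneOn hτ0 (hτ0.trans_le hτT) hτT
      have h2 : v x₀ - -v y ≤ 2 * M := by
        linarith [(abs_le.1 (hM x₀)).2, (abs_le.1 (hM y)).2]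
      calc (v x₀ - -v y) * S.j ‖T y - x₀‖ ≤ 2 * M * S.j ‖T y - x₀‖ :=
            mul_le_mul_of_nonneg_right h2 (S.j_nonneg _)
        _ ≤ C₀ := mul_le_mul_of_nonneg_left h1 (by linarith)
    · exact (hs_nonpos hρ hy h).trans (indicator_nonneg (fun _ _ => hC₀) _)
  set ρ' := min (min ρ₀ τ) (‖y₁ - x₀‖ / 2)
  have hy₁pos : 0 < ‖y₁ - x₀‖ := norm_pos_iff.2 (sub_ne_zero.2 hne)
  have hρ'pos : 0 < ρ' := lt_min (lt_min hρ₀ hτ0) (half_pos hy₁pos)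
  have hρ'τ : ρ' ≤ τ := (min_le_left _ _).trans (min_le_right _ _)
  have hρ'ρ₀ : ρ' ≤ ρ₀ := (min_le_left _ _).trans (min_le_left _ _)
  have hρ'y₁ : ρ' < ‖y₁ - x₀‖ := (min_le_right _ _).trans_lt (half_lt_self hy₁pos)
  set Q : Set (Rd d) := {y | ⟪y, e⟫ < μ} ∩ {y | ρ' ≤ ‖y - x₀‖} with hQ
  have hcin : Continuous fun y : Rd d => ⟪y, e⟫ := by fun_prop
  have hcno : Continuous fun y : Rd d => ‖y - x₀‖ := by fun_prop
  have hQm : MeasurableSet Q :=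
    (isOpen_lt hcin continuous_const).measurableSet.inter
      (isClosed_le continuous_const hcno).measurableSet
  have hQ_int : Integrable (Q.indicator (s ρ')) := (hs_int ρ' hρ'pos).indicator hQm
  have hQ_neg : ∫ y, Q.indicator (s ρ') y < 0 := by
    have hnn : 0 ≤ fun y => -Q.indicator (s ρ') y := by
      intro y
      by_cases hy : y ∈ Q
      · simp only [indicator_of_mem hy, Pi.zero_apply]
        linarith [hs_nonpos hρ'pos hy.1.le hy.2]
      · simp [indicator_of_notMem hy]
    have h1 := (integral_pos_iff_support_of_nonneg hnn hQ_int.neg).2 ?_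
    · rw [integral_neg] at h1
      linarith
    · set O : Set (Rd d) := ({y | ⟪y, e⟫ < μ} ∩ {y | ρ' < ‖y - x₀‖}) ∩ {y | v x₀ < v y}
      have hO : IsOpen O := ((isOpen_lt hcin continuous_const).inter
        (isOpen_lt continuous_const hcno)).inter (isOpen_lt continuous_const hv)
      refine (hO.measure_pos volume ⟨y₁, ⟨hy₁, hρ'y₁⟩, hvy₁⟩).trans_le (measure_mono ?_)
      rintro y ⟨⟨h2, h3⟩, h4⟩
      have h2' : ⟪y, e⟫ < μ := h2
      have h3' : ρ' < ‖y - x₀‖ := h3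
      have h4' : v x₀ < v y := h4
      have hyQ : y ∈ Q := ⟨h2, h3'.le⟩
      have hpos : 0 < ‖y - x₀‖ := hρ'pos.trans h3'
      have hlt := norm_sub_lt_norm_reflAt_sub he hx₀ h2'
      have hjlt := S.j_strictAntiOn hpos (hpos.trans hlt) hlt
      rw [Function.mem_support, indicator_of_mem hyQ, hsplit hρ'pos h2'.le h3'.le]
      have h5 := mul_pos (sub_pos.2 h4') (sub_pos.2 hjlt)
      have h6 := mul_nonneg (neg_nonneg.2 hneg) (S.j_nonneg ‖T y - x₀‖)
      apply ne_of_gt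
      linarith
  have hbound : ∀ ρ, 0 < ρ → ρ ≤ ρ' →
      0 ≤ 2 * (∫ _ in ball x₀ ρ, C₀) + ∫ y, Q.indicator (s ρ') y := by
    intro ρ hρ hρρ'
    have hI : Integrable ((ball x₀ ρ).indicator fun _ => C₀) :=
      (integrable_indicator_iff measurableSet_ball).2
        (integrableOn_const measure_ball_lt_top.ne)
    have hIT : Integrable fun y => (ball x₀ ρ).indicator (fun _ => C₀) (T y) :=
      ((measurePreserving_reflAt he μ).integrable_comp_emb hT_emb).2 hI
    have hII : Integrable fun y => (ball x₀ ρ).indicator (fun _ => C₀) y +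
      (ball x₀ ρ).indicator (fun _ => C₀) (T y) := hI.add hIT
    have hval : ∫ y, ((ball x₀ ρ).indicator (fun _ => C₀) y +
        (ball x₀ ρ).indicator (fun _ => C₀) (T y) + Q.indicator (s ρ') y) =
        2 * (∫ _ in ball x₀ ρ, C₀) + ∫ y, Q.indicator (s ρ') y := by
      rw [integral_add hII hQ_int, integral_add hI hIT,
        (measurePreserving_reflAt he μ).integral_comp hT_emb,
        integral_indicator measurableSet_ball, two_mul]
    rw [← hval]
    refine (hs_nonneg ρ hρ (hρρ'.trans hρ'ρ₀)).trans
      (integral_mono (hs_int ρ hρ) (hII.add hQ_int) fun y => ?_)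
    have hn1 : 0 ≤ (ball x₀ ρ).indicator (fun _ => C₀) y := indicator_nonneg (fun _ _ => hC₀) _
    have hn2 : 0 ≤ (ball x₀ ρ).indicator (fun _ => C₀) (T y) :=
      indicator_nonneg (fun _ _ => hC₀) _
    simp only
    by_cases hy : y ∈ Q
    · have h1 : ⟪y, e⟫ ≤ μ := le_of_lt hy.1
      have h2 : ρ' ≤ ‖y - x₀‖ := hy.2
      rw [indicator_of_mem hy, hsplit hρ h1 (hρρ'.trans h2), hsplit hρ'pos h1 h2]
      linarith
    · rw [indicator_of_notMem hy, add_zero]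
      rcases le_or_gt ⟪y, e⟫ μ with h | h
      · have := hs_le hρ (hρρ'.trans hρ'τ) h
        linarith
      · have h1 : ⟪T y, e⟫ ≤ μ := by rw [inner_reflAt he]; linarith
        have := hs_le hρ (hρρ'.trans hρ'τ) h1
        rw [hs_symm] at this
        linarith
  have hlim := ((tendsto_setIntegral_ball_zero hd (x := x₀) (h := fun _ => C₀)
    (integrableOn_const measure_ball_lt_top.ne)).const_mul 2).add_const
    (∫ y, Q.indicator (s ρ') y)
  rw [mul_zero, zero_add] at hlim
  have : 0 ≤ ∫ y, Q.indicator (s ρ') y := by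
    refine ge_of_tendsto hlim ?_
    filter_upwards [tendsto_one_div_add_atTop_nhds_zero_nat.eventually_le_const hρ'pos] with n hn
    exact hbound _ (by positivity) hn
  linarith

end PsiSetting

section Touching

variable {d : ℕ} {e : Rd d}

lemma gradient_neg (φ : Rd d → ℝ) (x : Rd d) :
    gradient (fun y => -φ y) x = -gradient φ x := by
  rw [gradient, gradient, ← map_neg, fderiv_fun_neg]

lemma TestAt.neg {x : Rd d} {φ : Rd d → ℝ} (h : TestAt x φ) : TestAt x fun y => -φ y := by
  obtain ⟨⟨M, hM⟩, hc, U, hU, hφ⟩ := h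
  exact ⟨⟨M, fun y => by rw [abs_neg]; exact hM y⟩, hc.neg, U, hU, hφ.neg⟩

lemma psiOp_neg (S : PsiSetting d) (φ : Rd d → ℝ) (x : Rd d) :
    psiOp S (fun y => -φ y) x = -psiOp S φ x := by
  rw [psiOp, psiOp, ← integral_neg]
  congr 1
  ext z
  rw [gradient_neg, inner_neg_right]
  split_ifs <;> ring

lemma uniformContinuous_reflAt (he : ‖e‖ = 1) (μ : ℝ) :
    UniformContinuous (reflAt e μ : Rd d → Rd d) := by
  have h : reflAt e μ = (fun x => x + (2 * μ) • e) ∘ linRefl e := by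
    ext1 x; exact reflAt_eq he x
  rw [h]
  exact (uniformContinuous_id.add uniformContinuous_const).comp
    (linRefl e).isometry.uniformContinuous

lemma uniformContinuous_of_holder {u : Rd d → ℝ} {C β : ℝ} (hβ : 0 < β)
    (h : ∀ x y, |u x - u y| ≤ C * ‖x - y‖ ^ β) : UniformContinuous u := by
  have hlim : Tendsto (fun t : ℝ => C * t ^ β) (𝓝 0) (𝓝 0) := by
    have h1 := (Real.continuousAt_rpow_const 0 β (Or.inr hβ.le)).tendsto.const_mul C
    rwa [Real.zero_rpow hβ.ne', mul_zero] at h1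
  rw [Metric.uniformContinuous_iff]
  intro ε hε
  obtain ⟨δ, hδ, hball⟩ := Metric.eventually_nhds_iff.1 (hlim.eventually_lt_const hε)
  refine ⟨δ, hδ, fun {x y} hxy => ?_⟩
  rw [Real.dist_eq]
  refine (h x y).trans_lt (hball ?_)
  rwa [Real.dist_eq, sub_zero, abs_norm, ← dist_eq_norm]

/-- A point of `S` from which some open ray avoids `S` lies on the frontier of `S`. -/
lemma mem_frontier_of_ray {S : Set (Rd d)} {q a : Rd d} (hq : q ∈ S)
    (h : ∀ t : ℝ, 0 < t → q + t • a ∉ S) : q ∈ frontier S := by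
  rw [frontier_eq_closure_inter_closure]
  refine ⟨subset_closure hq, ?_⟩
  have hcont : Continuous fun t : ℝ => q + t • a := by fun_prop
  have h0 : (0 : ℝ) ∈ closure (Ioi 0) := by rw [closure_Ioi]; exact mem_Ici.2 le_rfl
  have h1 := map_mem_closure hcont h0 (t := Sᶜ) fun t ht => h t ht
  simpa using h1

/-- A closed set with `C²` boundary is not contained in the hyperplane through one of its frontier
points. -/
lemma HasC2BoundaryClosed.exists_inner_ne (he : ‖e‖ = 1) {G : Set (Rd d)}
    (hG : HasC2BoundaryClosed G) {p : Rd d} (hp : p ∈ frontier G) (hpG : p ∈ G) :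
    ∃ q ∈ G, ⟪q, e⟫ ≠ ⟪p, e⟫ := by
  obtain ⟨U, f, hU, hpU, hf, hf', hGU⟩ := hG p hp
  have hfp : f p ≤ 0 := (hGU.subset ⟨hpG, hpU⟩).2
  have hdiff : DifferentiableAt ℝ f p :=
    (hf.contDiffAt (hU.mem_nhds hpU)).differentiableAt (by norm_num)
  obtain ⟨a, ha, hae⟩ : ∃ a, fderiv ℝ f p a < 0 ∧ ⟪a, e⟫ ≠ 0 := by
    obtain ⟨b, hb⟩ : ∃ b, fderiv ℝ f p b ≠ 0 := by
      by_contra! hcon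
      exact hf' p hpU (ContinuousLinearMap.ext hcon)
    obtain ⟨b, hb⟩ : ∃ b, fderiv ℝ f p b < 0 := by
      rcases hb.lt_or_gt with h | h
      · exact ⟨b, h⟩
      · exact ⟨-b, by rw [map_neg]; linarith⟩
    by_cases hbe : ⟪b, e⟫ = 0
    · rcases le_or_gt (fderiv ℝ f p e) 0 with h | h
      · refine ⟨b + e, by rw [map_add]; linarith, ?_⟩
        rw [inner_add_left, hbe, real_inner_self_eq_norm_sq, he]
        norm_num
      · refine ⟨b - e, by rw [map_sub]; linarith, ?_⟩
        rw [inner_sub_left, hbe, real_inner_self_eq_norm_sq, he]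
        norm_num
    · exact ⟨b, hb, hbe⟩
  have hline : HasDerivAt (fun t : ℝ => f (p + t • a)) (fderiv ℝ f p a) 0 := by
    have h1 : HasDerivAt (fun t : ℝ => p + t • a) a 0 := by
      simpa using ((hasDerivAt_id (0 : ℝ)).smul_const a).const_add p
    have h2 : HasFDerivAt f (fderiv ℝ f p) (p + (0 : ℝ) • a) := by
      simpa using hdiff.hasFDerivAt
    exact h2.comp_hasDerivAt 0 h1
  have hev1 : ∀ᶠ t in 𝓝[>] (0 : ℝ), f (p + t • a) < f p := by
    have h1 := (hasDerivAt_iff_tendsto_slope.1 hline).mono_left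
      (nhdsWithin_mono 0 (fun t (ht : 0 < t) => ht.ne'))
    filter_upwards [h1.eventually_lt_const ha, self_mem_nhdsWithin] with t ht (ht0 : 0 < t)
    rw [slope_def_field, sub_zero, zero_smul, add_zero] at ht
    by_contra! hcon
    exact absurd ht (not_lt.2 (div_nonneg (by linarith) ht0.le))
  have hev2 : ∀ᶠ t in 𝓝[>] (0 : ℝ), p + t • a ∈ U := by
    have hcont : Continuous fun t : ℝ => p + t • a := by fun_prop
    refine (hcont.tendsto 0).eventually_mem ?_ |>.filter_mono nhdsWithin_le_nhds
    simpa using hU.mem_nhds hpU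
  obtain ⟨t, ht1, ht2, ht0⟩ := (hev1.and (hev2.and self_mem_nhdsWithin)).exists
  refine ⟨p + t • a, (hGU.superset ⟨ht2, ht1.le.trans hfp⟩).1, ?_⟩
  rw [inner_add_left, real_inner_smul_left, ne_eq, add_eq_left]
  exact mul_ne_zero (ne_of_gt ht0) hae

end Touching

/-- A bounded closed set symmetric about `{x·e = μ}`, one component of which has `C²` boundary,
produces a touching point at level `μ`. -/
lemma sit1_of_symmetric {d : ℕ} {e : Rd d} (he : ‖e‖ = 1) {G K : Set (Rd d)} {μ : ℝ}
    (hGc : IsCompact G) (hKG : K ⊆ G) (hKn : K.Nonempty)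
    (hK : HasC2BoundaryClosed K) (hsymm : ∀ x ∈ G, reflAt e μ x ∈ G) : Sit1 G e μ := by
  have hcin : Continuous fun y : Rd d => ⟪y, e⟫ := by fun_prop
  have hray : ∀ (q : Rd d) (t : ℝ), ⟪q + t • e, e⟫ = ⟪q, e⟫ + t := fun q t => by
    rw [inner_add_left, real_inner_smul_left, real_inner_self_eq_norm_sq, he]; ring
  obtain ⟨p, hpG, hp⟩ := hGc.exists_isMaxOn (hKn.mono hKG) hcin.continuousOn
  have hmax : ∀ y ∈ G, ⟪y, e⟫ ≤ ⟪p, e⟫ := fun y hy => hp hy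
  rcases lt_or_ge μ ⟪p, e⟫ with hlt | hle
  · have hnot : ∀ t : ℝ, 0 < t → p + t • e ∉ G := fun t ht hmem => by
      have := hmax _ hmem
      rw [hray] at this
      linarith
    have hrefl : ∀ t : ℝ, reflAt e μ (reflAt e μ p + t • (-e)) = p + t • e := fun t => by
      rw [reflAt, inner_add_left, inner_reflAt he, real_inner_smul_left, inner_neg_left,
        real_inner_self_eq_norm_sq, he, reflAt]
      module
    refine ⟨reflAt e μ p, mem_frontier_of_ray (a := -e) (hsymm p hpG) fun t ht hmem => ?_,
      mem_frontier_of_ray (a := -e) ⟨p, ⟨hpG, hlt⟩, rfl⟩ ?_, ?_⟩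
    · exact hnot t ht (hrefl t ▸ hsymm _ hmem)
    · rintro t ht ⟨y, hy, hyeq⟩
      apply hnot t ht
      rw [← hrefl t, ← hyeq, reflAt_reflAt he]
      exact hy.1
    · rw [inner_reflAt he]
      intro h
      linarith
  · exfalso
    have hplane : ∀ y ∈ G, ⟪y, e⟫ = μ := fun y hy => by
      have h1 := hmax y hy
      have h2 := hmax _ (hsymm y hy)
      rw [inner_reflAt he] at h2
      linarith
    obtain ⟨q, hq⟩ := hKn
    have hqf : q ∈ frontier K := mem_frontier_of_ray (a := e) hq fun t ht hmem => by
      have h1 := hplane _ (hKG hmem)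
      rw [hray, hplane _ (hKG hq)] at h1
      linarith
    obtain ⟨y, hy, hne⟩ := hK.exists_inner_ne he hqf hq
    exact hne ((hplane y (hKG hy)).trans (hplane q (hKG hq)).symm)

/-- Strong maximum principle for `u - u ∘ R` at an interior nonpositive minimum. -/
lemma sub_reflAt_eq_zero_of_isMin {d : ℕ} (hd : 0 < d) (S : PsiSetting d) {G : Set (Rd d)}
    (hGc : IsClosed G) {A : ℝ} {f : ℝ → ℝ} (hf : ContinuousOn f (Icc 0 A)) {u : Rd d → ℝ}
    (hu : UniformContinuous u) (hu0 : ∀ x, u x ∈ Icc 0 A)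
    (hsol : IsSol S Gᶜ (fun _ => 0) (fun x => f (u x)) u) {e : Rd d} (he : ‖e‖ = 1) {μ : ℝ}
    {x₀ : Rd d} (hx₀ : ⟪x₀, e⟫ < μ) (hx₀G : x₀ ∉ G) (hRx₀G : reflAt e μ x₀ ∉ G)
    (hneg : u x₀ - u (reflAt e μ x₀) ≤ 0)
    (hmin : ∀ y, ⟪y, e⟫ < μ → u x₀ - u (reflAt e μ x₀) ≤ u y - u (reflAt e μ y))
    (hle : f (u (reflAt e μ x₀)) ≤ f (u x₀)) :
    ∀ y, ⟪y, e⟫ < μ → u y - u (reflAt e μ y) = 0 := by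
  have hR := uniformContinuous_reflAt he μ
  have hw : UniformContinuous fun y => u (reflAt e μ y) := hu.comp hR
  have huM : ∀ y, |u y| ≤ A := fun y => abs_le.2 ⟨by linarith [(hu0 y).1, (hu0 y).2], (hu0 y).2⟩
  have hfu : Continuous fun y => f (u y) := hf.comp_continuous hu.continuous hu0
  have hcin : Continuous fun y : Rd d => ⟪y, e⟫ := by fun_prop
  have hopen : IsOpen ({y : Rd d | ⟪y, e⟫ < μ} ∩ Gᶜ ∩ reflAt e μ ⁻¹' Gᶜ) :=
    ((isOpen_lt hcin continuous_const).inter hGc.isOpen_compl).inter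
      (hGc.isOpen_compl.preimage hR.continuous)
  obtain ⟨r, hr, hball⟩ := Metric.isOpen_iff.1 hopen x₀ ⟨⟨hx₀, hx₀G⟩, hRx₀G⟩
  have hsup : ∀ x ∈ Gᶜ, S.SatisfiesSuperAt u x (f (u x)) := fun x hx =>
    S.satisfiesSuperAt_of_visc hu.continuous huM fun φ h1 h2 h3 => by
      simpa using hsol.2.2 x hx φ h1 h2 h3
  have hsub : ∀ x ∈ Gᶜ, S.SatisfiesSuperAt (fun y => -u y) x (-f (u x)) := fun x hx =>
    S.satisfiesSuperAt_of_visc (u := fun y => -u y) hu.continuous.neg (M := A)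
      (fun y => by rw [abs_neg]; exact huM y) fun φ h1 h2 h3 => by
      have h4 := hsol.1.2 x hx (fun y => -φ y) h1.neg (by rw [h2, neg_neg])
        fun y hy => by linarith [h3 y hy]
      rw [psiOp_neg] at h4
      linarith
  refine S.eq_zero_of_antisymm hd he (v := fun y => u y - u (reflAt e μ y))
    (hu.continuous.sub hw.continuous) (M := A + A)
    (fun y => (abs_sub _ _).trans (add_le_add (huM _) (huM _)))
    (fun y => by rw [reflAt_reflAt he]; ring) hx₀ hneg hmin (ρ₀ := min 1 (r / 4)) (by positivity)
    fun ρ hρ hρ' => (sub_nonneg.2 hle).trans ?_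
  exact S.sub_le_setIntegral_of_isLocalMin hd hu.continuous hw huM (fun y => huM _) (r := r)
    (g := fun x => f (u x)) (h := fun x => f (u (reflAt e μ x)))
    (fun x hx => hsup x (hball hx).1.2)
    (fun y hy => PsiSetting.SatisfiesSuperAt.comp_reflAt S he μ (u := fun x => -u x) (hsub _ (hball hy).2))
    (fun x hx => hmin x (hball hx).1.1) hfu.continuousAt
    (hfu.comp hR.continuous).continuousAt hρ (hρ'.trans (min_le_left _ _))
    (hρ'.trans (min_le_right _ _))

/-- For hyperplanes far away in direction `e`, the reflected difference is nonnegative. -/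
lemma exists_forall_sub_reflAt_nonneg {d : ℕ} (hd : 0 < d) (S : PsiSetting d) {G : Set (Rd d)}
    (hGc : IsCompact G) {A : ℝ} {f : ℝ → ℝ} (hf : ContinuousOn f (Icc 0 A)) {f₀ : ℝ}
    (hf₀ : 0 < f₀) (hmono : AntitoneOn f (Icc 0 f₀)) {u : Rd d → ℝ}
    (hu : UniformContinuous u) (hu0 : ∀ x, u x ∈ Icc 0 A) (hG : ∀ x ∈ G, u x = A)
    (hsol : IsSol S Gᶜ (fun _ => 0) (fun x => f (u x)) u)
    (hdecay : Tendsto u (cocompact (Rd d)) (𝓝 0)) {e : Rd d} (he : ‖e‖ = 1) (lam₀ : ℝ) :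
    ∃ lam, lam₀ ≤ lam ∧ ∀ μ, lam < μ → ∀ x : Rd d, ⟪x, e⟫ < μ →
      0 ≤ u x - u (reflAt e μ x) := by
  have hcin : Continuous fun y : Rd d => ⟪y, e⟫ := by fun_prop
  obtain ⟨a, ha⟩ := (hGc.image hcin).bddAbove
  obtain ⟨b, hb⟩ : ∃ b, ∀ y : Rd d, b < ⟪y, e⟫ → u y < f₀ := by
    have h1 := hdecay.eventually_lt_const hf₀
    rw [← cobounded_eq_cocompact, ← comap_norm_atTop, eventually_comap] at h1
    obtain ⟨b, hb⟩ := eventually_atTop.1 h1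
    refine ⟨b, fun y hy => hb ‖y‖ ?_ y rfl⟩
    have := real_inner_le_norm y e
    rw [he, mul_one] at this
    linarith
  refine ⟨max lam₀ (max a b), le_max_left _ _, fun μ hμ x hx => ?_⟩
  have haμ : a < μ := ((le_max_left a b).trans (le_max_right _ _)).trans_lt hμ
  have hbμ : b < μ := ((le_max_right a b).trans (le_max_right _ _)).trans_lt hμ
  by_contra! hcon
  set v : Rd d → ℝ := fun y => u y - u (reflAt e μ y) with hv
  have hvc : Continuous v :=
    hu.continuous.sub (hu.continuous.comp (uniformContinuous_reflAt he μ).continuous)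
  have hv0 : Tendsto v (cocompact (Rd d)) (𝓝 0) := by
    have h1 := hdecay.comp (reflAtHomeomorph he μ).isClosedEmbedding.tendsto_cocompact
    rw [← sub_zero (0 : ℝ)]
    exact hdecay.sub h1
  obtain ⟨x₀, hx₀, hx₀min⟩ := hvc.continuousOn.exists_isMinOn' (s := {y : Rd d | ⟪y, e⟫ ≤ μ})
    (isClosed_le hcin continuous_const) (x₀ := x) hx.le
    ((hv0.eventually_const_le hcon).filter_mono inf_le_left)
  have hmin : ∀ y, ⟪y, e⟫ < μ → v x₀ ≤ v y := fun y hy => hx₀min (mem_ofPred.2 hy.le)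
  have hneg : v x₀ < 0 := (hmin x hx).trans_lt hcon
  have hx₀lt : ⟪x₀, e⟫ < μ := by
    refine lt_of_le_of_ne hx₀ fun h => ?_
    simp only [hv, reflAt_of_inner_eq h, sub_self, lt_self_iff_false] at hneg
  have hneg' : u x₀ < u (reflAt e μ x₀) := sub_neg.1 hneg
  have hx₀G : x₀ ∉ G := fun h => by
    rw [hG _ h] at hneg'
    exact absurd (hu0 _).2 (not_le.2 hneg')
  have hRin : μ < ⟪reflAt e μ x₀, e⟫ := by rw [inner_reflAt he]; linarith
  have hRx₀G : reflAt e μ x₀ ∉ G := fun h => by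
    exact absurd (ha (mem_image_of_mem _ h)) (not_le.2 (haμ.trans hRin))
  have hRf₀ := hb _ (hbμ.trans hRin)
  have hzero := sub_reflAt_eq_zero_of_isMin hd S hGc.isClosed hf hu hu0 hsol he hx₀lt hx₀G hRx₀G
    hneg.le hmin (hmono ⟨(hu0 _).1, (hneg'.trans hRf₀).le⟩ ⟨(hu0 _).1, hRf₀.le⟩ hneg'.le)
  exact hneg.ne (hzero x₀ hx₀lt)

/-- **Lemma 4.2** (moving planes up to the critical position): in the setting
of Theorem 2.3, `(S_λ)` holds for every `λ > λ*`, and `v_{λ*} ≥ 0` in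
`H^{λ*}`. -/
theorem moving_plane_up_to_critical
    {d : ℕ} (hd : 2 ≤ d) (S : PsiSetting d) (hker : S.kernelCond)
    (V : ℝ → ℝ) (hV : IsRenewal S.Ψ V)
    (n : ℕ) (hn : 0 < n) (G : Fin n → Set (Rd d))
    (hGc : ∀ k, IsCompact (G k)) (hGconn : ∀ k, IsConnected (G k))
    (hGC2 : ∀ k, HasC2BoundaryClosed (G k))
    (hGdisj : ∀ k l, k ≠ l → Disjoint (G k) (G l))
    (A : ℝ) (hA : 0 < A)
    (f : ℝ → ℝ) (hf : ∃ L : ℝ≥0, LipschitzOnWith L f (Set.Icc 0 A))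
    (f₀ : ℝ) (hf₀ : 0 < f₀ ∧ f₀ ≤ A) (hmono : AntitoneOn f (Set.Icc 0 f₀))
    (Ak : Fin n → ℝ) (hAk : ∀ k, Ak k ≤ 0)
    (u : Rd d → ℝ)
    (β : ℝ) (hβ : 0 < β ∧ β < 1)
    (hHolder : ∃ C > (0:ℝ), ∀ x y, |u x - u y| ≤ C * ‖x - y‖ ^ β)
    (hsol : IsSol S ((⋃ k, G k)ᶜ) (fun _ => 0) (fun x => f (u x)) u)
    (hG : ∀ x ∈ ⋃ k, G k, u x = A)
    (htr : ∀ k, ∀ x ∈ frontier (G k),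
      HasVTrace V ((⋃ k, G k)ᶜ) (fun z => u z - A) x (Ak k))
    (hbound : ∀ x ∉ ⋃ k, G k, 0 ≤ u x ∧ u x < A)
    (hdecay : Filter.Tendsto u (Filter.cocompact (Rd d)) (nhds 0))
    (e : Rd d) (he : ‖e‖ = 1)
    (lam₀ : ℝ)
    (hlam₀ : IsGreatest
      {lam : ℝ | Sit1 (⋃ k, G k) e lam ∨ Sit2 (⋃ k, G k) e lam} lam₀)
    (lamStar : ℝ)
    (hlamStar : lamStar = sInf {lam : ℝ | lam₀ ≤ lam ∧
      ∀ μ : ℝ, lam < μ → ∀ x : Rd d, ⟪x, e⟫ < μ → 0 ≤ u x - u (reflAt e μ x)})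
    :
    (∀ lam : ℝ, lamStar < lam → ∀ μ : ℝ, lam ≤ μ → ∀ x : Rd d, ⟪x, e⟫ < μ →
      x ∉ (⋃ k, G k) → x ∉ reflAt e μ '' (⋃ k, G k) →
      0 < u x - u (reflAt e μ x)) ∧
    (∀ x : Rd d, ⟪x, e⟫ < lamStar → 0 ≤ u x - u (reflAt e lamStar x)) := by
  set G' : Set (Rd d) := ⋃ k, G k with hG'
  have hd0 : 0 < d := by omega
  have hGc' : IsCompact G' := isCompact_iUnion hGc
  obtain ⟨C, -, hC⟩ := hHolder
  have hu : UniformContinuous u := uniformContinuous_of_holder hβ.1 hC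
  have hu0 : ∀ x, u x ∈ Icc 0 A := fun x => by
    by_cases hx : x ∈ G'
    · rw [hG x hx]; exact ⟨hA.le, le_rfl⟩
    · exact ⟨(hbound x hx).1, (hbound x hx).2.le⟩
  have hfc : ContinuousOn f (Icc 0 A) := by
    obtain ⟨L, hL⟩ := hf
    exact hL.continuousOn
  have hne := exists_forall_sub_reflAt_nonneg hd0 S hGc' hfc hf₀.1 hmono hu hu0 hG hsol hdecay he
    lam₀
  have hnonneg : ∀ μ, lamStar < μ → ∀ x : Rd d, ⟪x, e⟫ < μ → 0 ≤ u x - u (reflAt e μ x) := by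
    intro μ hμ
    rw [hlamStar] at hμ
    obtain ⟨lam, hlam, hlt⟩ := exists_lt_of_csInf_lt hne hμ
    exact hlam.2 μ hlt
  have hle : lam₀ ≤ lamStar := by
    rw [hlamStar]
    exact le_csInf hne fun _ h => h.1
  refine ⟨fun lam hlam μ hμ x hx hxG hRx => ?_, fun x hx => ?_⟩
  · have hRxG : reflAt e μ x ∉ G' := fun h => hRx ⟨_, h, reflAt_reflAt he x⟩
    have hμ' : lamStar < μ := hlam.trans_le hμ
    have hμ0 := hnonneg μ hμ'
    by_contra! hcon
    have hx0 : u x - u (reflAt e μ x) = 0 := le_antisymm hcon (hμ0 x hx)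
    have hzero := sub_reflAt_eq_zero_of_isMin hd0 S hGc'.isClosed hfc hu hu0 hsol he hx hxG hRxG
      hcon (fun y hy => hx0 ▸ hμ0 y hy) (by rw [sub_eq_zero.1 hx0])
    have hsymm : ∀ y, u (reflAt e μ y) = u y := fun y => by
      rcases lt_trichotomy ⟪y, e⟫ μ with h | h | h
      · linarith [hzero y h]
      · rw [reflAt_of_inner_eq h]
      · have := hzero (reflAt e μ y) (by rw [inner_reflAt he]; linarith)
        rw [reflAt_reflAt he] at this
        linarith
    have hGsymm : ∀ y ∈ G', reflAt e μ y ∈ G' := fun y hy => by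
      by_contra hcon'
      have := (hbound _ hcon').2
      rw [hsymm, hG y hy] at this
      exact lt_irrefl _ this
    have hsit := sit1_of_symmetric he hGc' (subset_iUnion G ⟨0, hn⟩) (hGconn _).nonempty
      (hGC2 _) hGsymm
    linarith [hlam₀.2 (Or.inl hsit)]
  · have hcont : Continuous fun μ => u x - u (reflAt e μ x) :=
      continuous_const.sub (hu.continuous.comp (continuous_reflAt.comp (Continuous.prodMk_left x)))
    refine ge_of_tendsto (x := 𝓝[>] lamStar) ((hcont.tendsto lamStar).mono_left nhdsWithin_le_nhds) ?_
    filter_upwards [self_mem_nhdsWithin (s := Ioi lamStar)] with μ hμ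
    exact hnonneg μ hμ x (hx.trans hμ)
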